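/- arXiv:1305.1831 — 8 statements merged into one kernel-verified Lean document; each statement's English description precedes it below -/
import Mathlib

section
/- Let q be a prime power and let u be a nonzero element of GF(q). The Dickson polynomial of the first kind D_n(x,u) is a permutation polynomial of GF(q) (i.e., the map x ↦ D_n(x,u) is a bijection of GF(q)) if and only if gcd(n, q^2 − 1) = 1. -/
open Polynomial in
theorem Polynomial.dickson_one_eval_add_mul {R : Type*} [CommRing R] (y z : R) :
    ∀ n, (dickson 1 (y * z) n).eval (y + z) = y ^ n + z ^ n
  | 0 => by simp only [pow_zero, dickson_zero]; norm_num
  | 1 => by simp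
  | n + 2 => by
    simp only [eval_sub, eval_mul, dickson_one_eval_add_mul y z _, eval_X, dickson_add_two, eval_C]
    ring

theorem eq_or_eq_of_add_eq_add_of_mul_eq_mul {K : Type*} [Field K] {a b c d : K}
    (hadd : a + b = c + d) (hmul : a * b = c * d) : a = c ∨ a = d := by
  have h : (a - c) * (a - d) = 0 := by linear_combination a * hadd - hmul
  simpa [sub_eq_zero] using h

theorem dickson_algebraMap_eval {F K : Type*} [Field F] [Field K] [Algebra F K]
    {u x : F} {y z : K} (hx : algebraMap F K x = y + z)
    (hu : algebraMap F K u = y * z) (n : ℕ) :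
    algebraMap F K ((Polynomial.dickson 1 u n).eval x) = y ^ n + z ^ n := by
  rw [← Polynomial.dickson_one_eval_add_mul y z n, ← hx, ← hu, ← Polynomial.map_dickson,
    Polynomial.eval_map_algebraMap, Polynomial.aeval_algebraMap_apply_eq_algebraMap_eval]

/-- Twisting the pair `y, z` by a root of unity `ζ` of order dividing `n` does not change
the value of the Dickson polynomial, but changes `y + z` for `y` or for `ζ y`. -/
theorem not_injective_dickson_of_pow_eq_one {F K : Type*} [Field F] [Field K]
    [Algebra F K] {u : F} (hu : u ≠ 0) {n : ℕ} {ζ : K} (hζ : ζ ^ n = 1)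
    (hζ2 : ζ ^ 2 ≠ 1) (hζ0 : ζ ≠ 0) {y : K} (hy : y ≠ 0)
    (hbase : ∀ k : ℕ, ∃ x : F,
      algebraMap F K x = ζ ^ k * y + algebraMap F K u / (ζ ^ k * y)) :
    ¬ Function.Injective (fun x : F => (Polynomial.dickson 1 u n).eval x) := by
  intro hinj
  have hζ1 : ζ ≠ 1 := by rintro rfl; simp at hζ2
  have twist : ∀ k : ℕ, (ζ ^ k * y) ^ 2 * ζ = algebraMap F K u := by
    intro k
    obtain ⟨x, hx⟩ := hbase k
    obtain ⟨x', hx'⟩ := hbase (k + 1)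
    have hw0 : ζ ^ k * y ≠ 0 := mul_ne_zero (pow_ne_zero _ hζ0) hy
    have hw : ζ ^ (k + 1) * y = ζ * (ζ ^ k * y) := by ring
    rw [hw] at hx'
    generalize ζ ^ k * y = w at *
    have hw0' : ζ * w ≠ 0 := mul_ne_zero hζ0 hw0
    have e : x = x' := by
      apply hinj
      apply (algebraMap F K).injective
      change algebraMap F K ((Polynomial.dickson 1 u n).eval x) =
        algebraMap F K ((Polynomial.dickson 1 u n).eval x')
      rw [dickson_algebraMap_eval hx (mul_div_cancel₀ _ hw0).symm,
        dickson_algebraMap_eval hx' (mul_div_cancel₀ _ hw0').symm]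
      simp only [div_pow, mul_pow, hζ, one_mul]
    subst e
    rw [hx] at hx'
    field_simp at hx'
    have : (1 - ζ) * (w ^ 2 * ζ - algebraMap F K u) = 0 := by linear_combination hx'
    rcases mul_eq_zero.1 this with h | h
    · exact absurd (sub_eq_zero.1 h).symm hζ1
    · exact sub_eq_zero.1 h
  have h0 := twist 0
  have h1 := twist 1
  apply hζ2
  have hu' : algebraMap F K u ≠ 0 := by simpa using hu
  apply mul_right_cancel₀ hu'
  rw [pow_zero, one_mul] at h0
  rw [pow_one] at h1
  linear_combination h1 - ζ ^ 2 * h0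

section FiniteField

variable {F : Type*} [Field F] [Fintype F] {K : Type*} [Field K] [Algebra F K]

theorem FiniteField.mem_range_algebraMap_of_pow_card_eq {x : K} (hx : x ^ Fintype.card F = x) :
    x ∈ Set.range (algebraMap F K) := by
  have hs : (Polynomial.X ^ Fintype.card F - Polynomial.X : Polynomial F).Splits := by
    rw [Polynomial.splits_iff_card_roots, FiniteField.roots_X_pow_card_sub_X,
      FiniteField.X_pow_card_sub_X_natDegree_eq F Fintype.one_lt_card]
    rfl
  refine hs.mem_range_of_isRoot
    (FiniteField.X_pow_card_sub_X_ne_zero F Fintype.one_lt_card) ?_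
  simp [hx]

/-- If Frobenius permutes a pair `y, z`, then `y + z` lies in the base field. -/
theorem exists_algebraMap_eq_add {y z : K}
    (h : y ^ Fintype.card F = y ∧ z ^ Fintype.card F = z ∨
      y ^ Fintype.card F = z ∧ z ^ Fintype.card F = y) :
    ∃ x : F, algebraMap F K x = y + z := by
  apply FiniteField.mem_range_algebraMap_of_pow_card_eq
  have hadd := map_add (FiniteField.frobeniusAlgHom F K) y z
  simp only [FiniteField.coe_frobeniusAlgHom] at hadd
  rw [hadd]
  rcases h with ⟨hy, hz⟩ | ⟨hy, hz⟩ <;> rw [hy, hz]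
  exact add_comm z y

theorem exists_add_mul_eq_algebraMap [IsAlgClosed K] {u : F} (hu : u ≠ 0) (x : F) :
    ∃ y z : K, y ^ (Fintype.card F ^ 2 - 1) = 1 ∧ z ^ (Fintype.card F ^ 2 - 1) = 1 ∧
      algebraMap F K x = y + z ∧ algebraMap F K u = y * z := by
  obtain ⟨y, hy⟩ : ∃ y : K, y * (algebraMap F K x - y) = algebraMap F K u := by
    have hd : (Polynomial.C (1 : K) * Polynomial.X ^ 2 +
        Polynomial.C (-algebraMap F K x) * Polynomial.X +
        Polynomial.C (algebraMap F K u)).degree ≠ 0 := by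
      rw [Polynomial.degree_quadratic one_ne_zero]
      decide
    obtain ⟨y, hy⟩ := IsAlgClosed.exists_root _ hd
    refine ⟨y, ?_⟩
    simp at hy
    linear_combination -hy
  obtain ⟨z, hz⟩ : ∃ z, z = algebraMap F K x - y := ⟨_, rfl⟩
  rw [← hz] at hy
  have hx : algebraMap F K x = y + z := by rw [hz]; ring
  have hu' : y * z ≠ 0 := by rw [hy]; simpa using hu
  have hφx := (FiniteField.frobeniusAlgHom F K).commutes x
  have hφu := (FiniteField.frobeniusAlgHom F K).commutes u
  rw [hx, map_add] at hφx
  rw [← hy, map_mul] at hφu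
  simp only [FiniteField.coe_frobeniusAlgHom] at hφx hφu
  have key : (y ^ Fintype.card F) ^ Fintype.card F = y ∧
      (z ^ Fintype.card F) ^ Fintype.card F = z := by
    rcases eq_or_eq_of_add_eq_add_of_mul_eq_mul hφx hφu with h | h
    · have h' : z ^ Fintype.card F = z := by linear_combination hφx - h
      simp [h, h']
    · have h' : z ^ Fintype.card F = y := by linear_combination hφx - h
      simp [h, h']
  have aux : ∀ w : K, w ≠ 0 → (w ^ Fintype.card F) ^ Fintype.card F = w →
      w ^ (Fintype.card F ^ 2 - 1) = 1 := by
    intro w hw h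
    have hq : 1 ≤ Fintype.card F ^ 2 := Nat.one_le_pow _ _ Fintype.card_pos
    apply mul_right_cancel₀ hw
    rw [← pow_succ, Nat.sub_add_cancel hq, sq, pow_mul, h, one_mul]
  exact ⟨y, z, aux y (left_ne_zero_of_mul hu') key.1, aux z (right_ne_zero_of_mul hu') key.2,
    hx, hy.symm⟩

theorem dickson_injective_of_gcd_eq_one {u : F} (hu : u ≠ 0) {n : ℕ}
    (hn : Nat.gcd n (Fintype.card F ^ 2 - 1) = 1) :
    Function.Injective (fun x : F => (Polynomial.dickson 1 u n).eval x) := by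
  intro x x' hxx'
  obtain ⟨y, z, hy, hz, hx, hyz⟩ :=
    exists_add_mul_eq_algebraMap (K := AlgebraicClosure F) hu x
  obtain ⟨y', z', hy', hz', hx', hyz'⟩ :=
    exists_add_mul_eq_algebraMap (K := AlgebraicClosure F) hu x'
  have cancel : ∀ {a b : AlgebraicClosure F}, a ^ (Fintype.card F ^ 2 - 1) = 1 →
      b ^ (Fintype.card F ^ 2 - 1) = 1 → b ≠ 0 → a ^ n = b ^ n → a = b := by
    intro a b ha hb hb0 hab
    have h1 : (a / b) ^ n = 1 := by rw [div_pow, hab, div_self (pow_ne_zero _ hb0)]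
    have h2 : (a / b) ^ (Fintype.card F ^ 2 - 1) = 1 := by rw [div_pow, ha, hb, div_one]
    have h3 : (a / b) ^ Nat.gcd n (Fintype.card F ^ 2 - 1) = 1 := pow_gcd_eq_one.2 ⟨h1, h2⟩
    rw [hn, pow_one] at h3
    exact (div_eq_one_iff_eq hb0).1 h3
  have hu' : algebraMap F (AlgebraicClosure F) u ≠ 0 := by simpa using hu
  have hy0 : y ≠ 0 := left_ne_zero_of_mul (hyz ▸ hu')
  have hy'0 : y' ≠ 0 := left_ne_zero_of_mul (hyz' ▸ hu')
  have hz'0 : z' ≠ 0 := right_ne_zero_of_mul (hyz' ▸ hu')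
  have hsum : y ^ n + z ^ n = y' ^ n + z' ^ n := by
    rw [← dickson_algebraMap_eval hx hyz, ← dickson_algebraMap_eval hx' hyz']
    exact congrArg _ hxx'
  have hprod : y ^ n * z ^ n = y' ^ n * z' ^ n := by
    rw [← mul_pow, ← mul_pow, ← hyz, ← hyz']
  apply (algebraMap F (AlgebraicClosure F)).injective
  rw [hx, hx']
  have hmul : y * z = y' * z' := hyz.symm.trans hyz'
  rcases eq_or_eq_of_add_eq_add_of_mul_eq_mul hsum hprod with h | h
  · have e := cancel hy hy' hy'0 h
    subst e
    rw [mul_left_cancel₀ hy0 hmul]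
  · have e := cancel hy hz' hz'0 h
    subst e
    rw [mul_comm y'] at hmul
    rw [mul_left_cancel₀ hy0 hmul, add_comm]

theorem not_injective_dickson_of_even {u : F} (hu : u ≠ 0) {n : ℕ} (h2 : (2 : F) ≠ 0) (hn : Even n) :
    ¬ Function.Injective (fun x : F => (Polynomial.dickson 1 u n).eval x) := by
  intro hinj
  have h : (1 : F) = -1 := by
    obtain ⟨y, z, -, -, hx, hyz⟩ :=
      exists_add_mul_eq_algebraMap (K := AlgebraicClosure F) hu 1
    apply hinj
    apply (algebraMap F (AlgebraicClosure F)).injective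
    have hx' : algebraMap F (AlgebraicClosure F) (-1) = -y + -z := by
      rw [map_neg, hx, neg_add]
    have hyz' : algebraMap F (AlgebraicClosure F) u = -y * -z := by rw [hyz, neg_mul_neg]
    exact (dickson_algebraMap_eval hx hyz n).trans (by
      rw [dickson_algebraMap_eval hx' hyz', hn.neg_pow, hn.neg_pow])
  apply h2
  linear_combination h

theorem not_injective_dickson_of_prime_dvd {u : F} (hu : u ≠ 0) {n p : ℕ} (hp : p.Prime)
    (hpn : p ∣ n) (hpq : p ∣ Fintype.card F ^ 2 - 1) :
    ¬ Function.Injective (fun x : F => (Polynomial.dickson 1 u n).eval x) := by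
  have hq : 1 < Fintype.card F := Fintype.one_lt_card
  have hpF : (p : F) ≠ 0 := by
    intro h0
    have h := (Nat.cast_dvd_cast (α := F) hpq)
    rw [h0, zero_dvd_iff, Nat.cast_sub (Nat.one_le_pow _ _ hq.le)] at h
    simp at h
  rcases eq_or_ne p 2 with rfl | hp2
  · exact not_injective_dickson_of_even hu (by exact_mod_cast hpF) (even_iff_two_dvd.2 hpn)
  have : NeZero (p : F) := ⟨hpF⟩
  obtain ⟨ζ, hζ⟩ := HasEnoughRootsOfUnity.exists_primitiveRoot (AlgebraicClosure F) p
  have hζ0 : ζ ≠ 0 := hζ.ne_zero hp.ne_zero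
  have hζn : ζ ^ n = 1 := (hζ.pow_eq_one_iff_dvd n).2 hpn
  have hζ2 : ζ ^ 2 ≠ 1 := fun h =>
    hp2 ((Nat.prime_dvd_prime_iff_eq hp Nat.prime_two).1 ((hζ.pow_eq_one_iff_dvd 2).1 h))
  have hu' : algebraMap F (AlgebraicClosure F) u ≠ 0 := by simpa using hu
  have huq : algebraMap F (AlgebraicClosure F) u ^ Fintype.card F = algebraMap F _ u := by
    rw [← map_pow, FiniteField.pow_card]
  have hfac : Fintype.card F ^ 2 - 1 = (Fintype.card F + 1) * (Fintype.card F - 1) := by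
    simpa using Nat.sq_sub_sq (Fintype.card F) 1
  rw [hfac] at hpq
  rcases hp.dvd_mul.1 hpq with h | h
  · obtain ⟨y, hy⟩ := IsAlgClosed.exists_pow_nat_eq
      (algebraMap F (AlgebraicClosure F) u) (Nat.succ_pos (Fintype.card F))
    have hy0 : y ≠ 0 := by
      rintro rfl
      exact hu' (by rw [← hy]; simp)
    refine not_injective_dickson_of_pow_eq_one hu hζn hζ2 hζ0 hy0 fun k => ?_
    have hw0 : ζ ^ k * y ≠ 0 := mul_ne_zero (pow_ne_zero _ hζ0) hy0
    have hw : (ζ ^ k * y) ^ (Fintype.card F + 1) = algebraMap F _ u := by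
      rw [mul_pow, hy, pow_right_comm, (hζ.pow_eq_one_iff_dvd _).2 h, one_pow, one_mul]
    have hw' : (ζ ^ k * y) ^ Fintype.card F = algebraMap F _ u / (ζ ^ k * y) := by
      rw [eq_div_iff hw0, ← pow_succ, hw]
    refine exists_algebraMap_eq_add (Or.inr ⟨hw', ?_⟩)
    rw [div_pow, huq, hw', div_div_cancel₀ hu']
  · refine not_injective_dickson_of_pow_eq_one hu hζn hζ2 hζ0 one_ne_zero fun k => ?_
    have hζq : ζ ^ Fintype.card F = ζ := by
      rw [← Nat.sub_add_cancel hq.le, pow_succ, (hζ.pow_eq_one_iff_dvd _).2 h, one_mul]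
    have hw : (ζ ^ k * 1) ^ Fintype.card F = ζ ^ k * 1 := by
      rw [mul_one, pow_right_comm, hζq]
    refine exists_algebraMap_eq_add (Or.inl ⟨hw, ?_⟩)
    rw [div_pow, huq, hw]

end FiniteField

/-- **Dickson permutation criterion.** For a finite field `F` of order `q`, a nonzero
`u ∈ F` and `n ≥ 1`, the Dickson polynomial of the first kind `D_n(x, u)` is a
permutation polynomial of `F` if and only if `gcd(n, q² - 1) = 1`. -/
theorem dickson_bijective_iff_gcd_eq_one
    (F : Type*) [Field F] [Fintype F] (u : F) (hu : u ≠ 0) (n : ℕ) (hn : 1 ≤ n) :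
    Function.Bijective (fun x : F => (Polynomial.dickson 1 u n).eval x) ↔
      Nat.gcd n (Fintype.card F ^ 2 - 1) = 1 := by
  rw [← Finite.injective_iff_bijective]
  refine ⟨fun hinj => ?_, dickson_injective_of_gcd_eq_one hu⟩
  by_contra hne
  obtain ⟨p, hp, hdvd⟩ := Nat.exists_prime_and_dvd hne
  exact not_injective_dickson_of_prime_dvd hu hp (hdvd.trans (Nat.gcd_dvd_left _ _))
    (hdvd.trans (Nat.gcd_dvd_right _ _)) hinj
end

section
/- Let q = 3^m with m odd and m not divisible by 3, and let u be a nonzero element of GF(q). Then D_u is a skew Hadamard difference set in the additive group (GF(q), +): D_u ∩ (−D_u) = ∅, D_u ∪ (−D_u) ∪ {0} = GF(q), |D_u| = (q−1)/2, and for every nonzero g ∈ GF(q) the number of ordered pairs (d₁, d₂) ∈ D_u × D_u with d₁ − d₂ = g equals (q−3)/4. -/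
/-- The sum of the ternary digits of `n`. -/
def ternaryWeight (n : ℕ) : ℕ := (Nat.digits 3 n).sum

theorem ternaryWeight_zero : ternaryWeight 0 = 0 := by simp [ternaryWeight]

theorem ternaryWeight_add_three_mul (r n : ℕ) (hr : r < 3) :
    ternaryWeight (r + 3 * n) = r + ternaryWeight n := by
  rcases Nat.eq_zero_or_pos (r + 3 * n) with h | h
  · obtain ⟨rfl, rfl⟩ : r = 0 ∧ n = 0 := by omega
    simp [ternaryWeight]
  · unfold ternaryWeight
    rw [Nat.digits_def' (by norm_num) h]
    have h1 : (r + 3 * n) % 3 = r := by omega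
    have h2 : (r + 3 * n) / 3 = n := by omega
    rw [h1, h2, List.sum_cons]

/-- A potential on the carries of the ternary addition `7 * a + 5 * b + c`. -/
def carryPotential : ℕ → ℕ
  | 0 => 0 | 1 => 1 | 2 => 0 | 3 => 1 | 4 => 2 | 5 => 1 | 6 => 2 | _ => 3

theorem carryPotential_step : ∀ k < 14, ∀ a < 3, ∀ b < 3, ∀ c < 3,
    (7 * a + 5 * b + c + k) % 3 = 1 →
      carryPotential ((7 * a + 5 * b + c + k) / 3) + 1 ≤ a + b + c + carryPotential k := by
  decide

theorem ternaryWeight_carry (m : ℕ) : ∀ a b c k l : ℕ, a < 3 ^ m → b < 3 ^ m → c < 3 ^ m →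
    k < 14 → 2 * (7 * a + 5 * b + c + k) + 1 = 3 ^ m + 2 * 3 ^ m * l →
    m + carryPotential l ≤
      ternaryWeight a + ternaryWeight b + ternaryWeight c + carryPotential k := by
  induction m with
  | zero =>
    intro a b c k l ha hb hc hk h
    have ha : a = 0 := by simpa using ha
    have hb : b = 0 := by simpa using hb
    have hc : c = 0 := by simpa using hc
    have : k = l := by subst ha hb hc; omega
    subst this; simp
  | succ m ih =>
    intro a b c k l ha hb hc hk h
    rw [pow_succ] at ha hb hc h
    have key : 2 * (7 * a + 5 * b + c + k) + 1 = 3 * (3 ^ m + 2 * 3 ^ m * l) := by rw [h]; ring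
    have step := carryPotential_step k hk (a % 3) (by omega) (b % 3) (by omega) (c % 3)
      (by omega) (by omega)
    have := ih (a / 3) (b / 3) (c / 3) ((7 * (a % 3) + 5 * (b % 3) + c % 3 + k) / 3) l
      (by omega) (by omega) (by omega) (by omega) (by omega)
    have ea := ternaryWeight_add_three_mul (a % 3) (a / 3) (by omega)
    have eb := ternaryWeight_add_three_mul (b % 3) (b / 3) (by omega)
    have ec := ternaryWeight_add_three_mul (c % 3) (c / 3) (by omega)
    rw [Nat.mod_add_div] at ea eb ec
    omega

/-- If `7 a + 5 b + c` is an odd multiple of `(3 ^ m - 1) / 2`, then the ternary weights of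
`a`, `b`, `c` add up to at least `m`. -/
theorem le_ternaryWeight_add (m a b c l : ℕ) (ha : a < 3 ^ m - 1) (hb : b < 3 ^ m - 1)
    (hc : c < 3 ^ m - 1) (h : 2 * (7 * a + 5 * b + c) = (3 ^ m - 1) * (2 * l + 1)) :
    m ≤ ternaryWeight a + ternaryWeight b + ternaryWeight c := by
  have hl : l < 14 := by
    by_contra! hl
    have : (3 ^ m - 1) * 29 ≤ (3 ^ m - 1) * (2 * l + 1) := Nat.mul_le_mul_left _ (by omega)
    omega
  have := ternaryWeight_carry m a b c l l (by omega) (by omega) (by omega) hl (by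
    have h3 : (3 ^ m - 1) * (2 * l + 1) + (2 * l + 1) = 3 ^ m + 2 * 3 ^ m * l := by
      rw [← Nat.succ_mul, Nat.succ_eq_add_one, Nat.sub_add_cancel (Nat.one_le_pow _ _ (by norm_num))]
      ring
    omega)
  omega

theorem WittVector.sq_sub_mul_add_sq_ne_zero {F : Type*} [Field F] [CharP F 3] [PerfectRing F 3]
    {a b : WittVector 3 F} (h : a * a - a * b + b * b = 0) : a = 0 ∧ b = 0 := by
  have h3 : (3 : WittVector 3 F) ≠ 0 := by
    exact_mod_cast WittVector.p_nonzero 3 F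
  have r3 : WittVector.constantCoeff (3 : WittVector 3 F) = 0 := by
    rw [map_ofNat]; exact_mod_cast CharP.cast_eq_zero F 3
  have hb : b = 0 := by
    by_contra hb
    have key : (2 * a - b) ^ 2 + 3 * b ^ 2 = 0 := by linear_combination 4 * h
    have hc : 2 * a - b ≠ 0 := by
      intro hc
      rw [hc] at key
      simp [h3, hb] at key
    obtain ⟨i, v, hv, hi⟩ := WittVector.exists_eq_pow_p_mul (p := 3) _ hc
    obtain ⟨j, w, hw, hj⟩ := WittVector.exists_eq_pow_p_mul (p := 3) _ hb
    rw [hi, hj] at key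
    push_cast at key
    rcases le_or_gt i j with hij | hij
    · obtain ⟨k, rfl⟩ := Nat.exists_eq_add_of_le hij
      have : v ^ 2 + 3 * (3 ^ k * w) ^ 2 = 0 := by
        apply mul_left_cancel₀ (pow_ne_zero (2 * i) h3)
        rw [mul_zero, ← key]; ring
      have := congrArg WittVector.constantCoeff this
      rw [map_add, map_mul, r3, zero_mul, add_zero, map_pow, map_zero] at this
      exact hv (pow_eq_zero_iff two_ne_zero |>.1 this)
    · obtain ⟨k, rfl⟩ := Nat.exists_eq_add_of_lt hij
      have : 3 * (3 ^ k * v) ^ 2 + w ^ 2 = 0 := by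
        apply mul_left_cancel₀ (pow_ne_zero (2 * j + 1) h3)
        rw [mul_zero, ← key]; ring
      have := congrArg WittVector.constantCoeff this
      rw [map_add, map_mul, r3, zero_mul, zero_add, map_pow, map_zero] at this
      exact hw (pow_eq_zero_iff two_ne_zero |>.1 this)
  subst hb
  simpa using h

theorem WittVector.charZero_of_charP_three (F : Type*) [Field F] [CharP F 3] :
    CharZero (WittVector 3 F) := by
  obtain ⟨n, hn⟩ := CharP.exists (WittVector 3 F)
  rcases CharP.char_is_prime_or_zero (WittVector 3 F) n with hp | rfl
  · have h := congrArg WittVector.constantCoeff (CharP.cast_eq_zero (WittVector 3 F) n)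
    rw [map_natCast, map_zero, CharP.cast_eq_zero_iff F 3] at h
    obtain rfl := (Nat.prime_dvd_prime_iff_eq Nat.prime_three hp).1 h
    exact absurd (CharP.cast_eq_zero (WittVector 3 F) 3) (WittVector.p_nonzero 3 F)
  · exact CharP.charP_to_charZero _

/-- The Witt vectors of `F` with a primitive cube root of unity adjoined. -/
abbrev EisensteinWitt (F : Type*) [Field F] := QuadraticAlgebra (WittVector 3 F) (-1) (-1)

namespace EisensteinWitt

variable {F : Type*} [Field F]

theorem norm_eq (z : EisensteinWitt F) :
    z.norm = z.re * z.re - z.re * z.im + z.im * z.im := by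
  rw [QuadraticAlgebra.norm_def]; ring

variable [CharP F 3]

theorem isDomain [PerfectRing F 3] : IsDomain (EisensteinWitt F) := by
  have : NoZeroDivisors (EisensteinWitt F) := by
    refine ⟨fun {x y} hxy => ?_⟩
    by_contra! hne
    have hx : x.norm ≠ 0 := by
      intro h0
      rw [norm_eq] at h0
      obtain ⟨h1, h2⟩ := WittVector.sq_sub_mul_add_sq_ne_zero h0
      exact hne.1 (QuadraticAlgebra.ext h1 h2)
    have := QuadraticAlgebra.norm_mem_nonZeroDivisors_iff.1 (mem_nonZeroDivisors_of_ne_zero hx)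
    exact hne.2 ((mul_left_mem_nonZeroDivisors_eq_zero_iff this).1 hxy)
  exact NoZeroDivisors.to_isDomain _

theorem charZero : CharZero (EisensteinWitt F) :=
  have : CharZero (WittVector 3 F) := WittVector.charZero_of_charP_three F
  charZero_of_injective_algebraMap (QuadraticAlgebra.algebraMap_injective (R := WittVector 3 F))

/-- The residue map, which sends the cube root of unity to `1`. -/
noncomputable def residue (F : Type*) [Field F] [CharP F 3] : EisensteinWitt F →+* F where
  toFun z := WittVector.constantCoeff z.re + WittVector.constantCoeff z.im
  map_zero' := by simp
  map_one' := by rw [QuadraticAlgebra.re_one, QuadraticAlgebra.im_one, map_zero, map_one, add_zero]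
  map_add' x y := by simp only [QuadraticAlgebra.re_add, QuadraticAlgebra.im_add, map_add]; ring
  map_mul' x y := by
    have h3 : (3 : F) = 0 := by exact_mod_cast CharP.cast_eq_zero F 3
    simp only [QuadraticAlgebra.re_mul, QuadraticAlgebra.im_mul, map_add, map_mul, map_neg,
      map_one]
    linear_combination (-WittVector.constantCoeff x.im * WittVector.constantCoeff y.im) * h3

theorem residue_apply (z : EisensteinWitt F) :
    residue F z = WittVector.constantCoeff z.re + WittVector.constantCoeff z.im := rfl

theorem isUnit_of_residue_ne_zero {x : EisensteinWitt F} (hx : residue F x ≠ 0) : IsUnit x := by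
  rw [QuadraticAlgebra.isUnit_iff_norm_isUnit]
  apply WittVector.isUnit_of_coeff_zero_ne_zero
  change WittVector.constantCoeff x.norm ≠ 0
  have h3 : (3 : F) = 0 := by exact_mod_cast CharP.cast_eq_zero F 3
  have : WittVector.constantCoeff x.norm = residue F x ^ 2 := by
    rw [norm_eq, residue_apply]
    simp only [map_add, map_sub, map_mul]
    linear_combination (-WittVector.constantCoeff x.re * WittVector.constantCoeff x.im) * h3
  rw [this]
  exact pow_ne_zero _ hx

end EisensteinWitt

universe v

/-- A perfect field of characteristic three is the residue ring of a domain of characteristic zero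
that contains Teichmüller representatives and a primitive cube root of unity. -/
theorem exists_domain_teichmuller_cube_root (F : Type v) [Field F] [CharP F 3] [PerfectRing F 3] :
    ∃ (R : Type v) (_ : CommRing R) (_ : IsDomain R) (_ : CharZero R) (res : R →+* F)
      (τ : F →* R) (ω : R), (∀ x, res x ≠ 0 → IsUnit x) ∧ (∀ x, res (τ x) = x) ∧ τ 0 = 0 ∧
        ω ^ 2 + ω + 1 = 0 := by
  refine ⟨EisensteinWitt F, inferInstance, EisensteinWitt.isDomain, EisensteinWitt.charZero,
    EisensteinWitt.residue F, (algebraMap (WittVector 3 F) (EisensteinWitt F) : _ →* _).comp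
      (WittVector.teichmuller 3), QuadraticAlgebra.omega,
    fun x hx => EisensteinWitt.isUnit_of_residue_ne_zero hx, fun x => ?_, ?_, ?_⟩
  · simp [EisensteinWitt.residue_apply, QuadraticAlgebra.algebraMap_eq]
  · simp [WittVector.teichmuller_zero]
  · rw [sq, QuadraticAlgebra.omega_mul_omega_eq_mk]
    apply QuadraticAlgebra.ext
    · simp [QuadraticAlgebra.re_one (R := WittVector 3 F)]
    · simp [QuadraticAlgebra.im_one (R := WittVector 3 F)]

section GaussSums

variable {F : Type*} [Field F] {R : Type*} [CommRing R]

/-- The inverse of the multiplicative character given by a multiplicative section `τ`. -/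
def invMulChar (τ : F →* R) (hτ0 : τ 0 = 0) : MulChar F R where
  toMonoidHom := τ.comp (invMonoidWithZeroHom : F →*₀ F).toMonoidHom
  map_nonunit' a ha := by
    obtain rfl : a = 0 := by simpa using ha
    change τ (0⁻¹) = 0
    rw [inv_zero, hτ0]

theorem invMulChar_apply (τ : F →* R) (hτ0 : τ 0 = 0) (x : F) :
    invMulChar τ hτ0 x = τ x⁻¹ := rfl

variable {res : R →+* F} {τ : F →* R} {hτ0 : τ 0 = 0}

theorem res_invMulChar_pow (hτ : ∀ x, res (τ x) = x) (i : ℕ) {x : F} (hx : x ≠ 0) :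
    res ((invMulChar τ hτ0 ^ i) x) = x⁻¹ ^ i := by
  have := MulChar.pow_apply_coe (invMulChar τ hτ0) i (Units.mk0 x hx)
  rw [Units.val_mk0] at this
  rw [this, map_pow, invMulChar_apply, hτ]

variable [Fintype F]

theorem invMulChar_pow_ne_one (hτ : ∀ x, res (τ x) = x) {j : ℕ} (hj : 0 < j)
    (hjq : j < Fintype.card F - 1) : invMulChar τ hτ0 ^ j ≠ 1 := by
  intro h
  have h1 : ∀ x : Fˣ, x ^ j = 1 := by
    intro x
    have h2 := congrArg res (DFunLike.congr_fun h ((x⁻¹ : Fˣ) : F))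
    rw [MulChar.pow_apply_coe, invMulChar_apply, MulChar.one_apply_coe, map_pow, hτ, map_one] at h2
    ext
    simpa using h2
  have := Nat.le_of_dvd hj ((FiniteField.forall_pow_eq_one_iff F j).1 h1)
  omega

theorem res_sum_invMulChar_pow [IsDomain R] (hτ : ∀ x, res (τ x) = x) {j : ℕ} (hj : 0 < j)
    (hjq : j < Fintype.card F - 1) : ∑ x, res ((invMulChar τ hτ0 ^ j) x) = 0 := by
  rw [← map_sum, MulChar.sum_eq_zero_of_ne_one (invMulChar_pow_ne_one hτ hj hjq), map_zero]

theorem res_jacobiSum_invMulChar [IsDomain R] (hτ : ∀ x, res (τ x) = x) (i : ℕ)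
    (hi : i + 1 < Fintype.card F - 1) :
    res (jacobiSum (invMulChar τ hτ0 ^ i) (invMulChar τ hτ0)) = -(i + 1 : F) := by
  classical
  have hJ (i : ℕ) : res (jacobiSum (invMulChar τ hτ0 ^ i) (invMulChar τ hτ0)) =
      ∑ x, res ((invMulChar τ hτ0 ^ i) x) * (1 - x)⁻¹ := by
    simp only [jacobiSum, map_sum, map_mul, invMulChar_apply, hτ]
  rw [hJ]
  induction i with
  | zero =>
    have h1 (x : F) : res ((invMulChar τ hτ0 ^ 0) x) * (1 - x)⁻¹ =
        (1 - x)⁻¹ - if x = 0 then 1 else 0 := by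
      by_cases hx : x = 0
      · subst hx; simp [MulChar.map_zero]
      · rw [res_invMulChar_pow hτ _ hx]; simp [hx]
    have h2 : ∑ x : F, (1 - x)⁻¹ = 0 := by
      rw [← res_sum_invMulChar_pow (hτ0 := hτ0) hτ one_pos (by omega)]
      refine Fintype.sum_equiv (Equiv.subLeft 1) _ _ fun x => ?_
      rw [pow_one, invMulChar_apply, hτ, Equiv.subLeft_apply]
    rw [Finset.sum_congr rfl fun x _ => h1 x, Finset.sum_sub_distrib, h2]
    simp
  | succ i ih =>
    have h1 (x : F) : res ((invMulChar τ hτ0 ^ (i + 1)) x) * (1 - x)⁻¹ =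
        res ((invMulChar τ hτ0 ^ (i + 1)) x) - (if x = 1 then 1 else 0) +
          res ((invMulChar τ hτ0 ^ i) x) * (1 - x)⁻¹ := by
      by_cases hx : x = 0
      · subst hx; simp [MulChar.map_zero]
      · rw [res_invMulChar_pow hτ _ hx, res_invMulChar_pow hτ _ hx]
        by_cases hx1 : x = 1
        · subst hx1; simp
        · have : 1 - x ≠ 0 := sub_ne_zero.2 (Ne.symm hx1)
          simp only [hx1, if_false]
          linear_combination (x⁻¹ ^ i * (1 - x)⁻¹) * mul_inv_cancel₀ hx +
            x⁻¹ ^ (i + 1) * mul_inv_cancel₀ this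
    rw [Finset.sum_congr rfl fun x _ => h1 x, Finset.sum_add_distrib, Finset.sum_sub_distrib,
      ih (by omega), res_sum_invMulChar_pow hτ (by omega) (by omega)]
    simp only [Finset.sum_ite_eq', Finset.mem_univ, if_true]
    push_cast
    ring

variable {π : R} {ψ : AddChar F R}

/-- A Stickelberger-type bound: `π` to the digit sum of `j` divides the Gauss sum of the `j`-th
power of the inverse Teichmüller character. -/
theorem pow_ternaryWeight_dvd_gaussSum [IsDomain R] [CharP F 3] (hu : ∀ x, res x ≠ 0 → IsUnit x)
    (hτ : ∀ x, res (τ x) = x) (hπ : ∀ x, π ∣ ψ x - 1)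
    (hψ : ∀ x, ψ (x ^ 3) = ψ x) (j : ℕ) (hj : j < Fintype.card F - 1) :
    π ^ ternaryWeight j ∣ gaussSum (invMulChar τ hτ0 ^ j) ψ := by
  induction j using Nat.strong_induction_on with
  | _ j ih =>
  rcases Nat.eq_zero_or_pos j with rfl | hj0
  · simp [ternaryWeight_zero]
  have hdigit := ternaryWeight_add_three_mul (j % 3) (j / 3) (by omega)
  rw [Nat.mod_add_div] at hdigit
  by_cases h3 : j % 3 = 0
  · rw [hdigit, h3, zero_add]
    convert ih (j / 3) (by omega) (by omega) using 1
    refine Fintype.sum_equiv (frobeniusEquiv F 3).toEquiv _ _ fun x => ?_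
    change _ = (invMulChar τ hτ0 ^ (j / 3)) (x ^ 3) * ψ (x ^ 3)
    rw [hψ, map_pow, ← MulChar.pow_apply' _ three_ne_zero, ← pow_mul]
    congr 3
    omega
  · obtain ⟨i, rfl⟩ : ∃ i, j = i + 1 := ⟨j - 1, by omega⟩
    have hi := ternaryWeight_add_three_mul (i % 3) (i / 3) (by omega)
    rw [Nat.mod_add_div] at hi
    have hw : ternaryWeight (i + 1) = ternaryWeight i + 1 := by
      have : i / 3 = (i + 1) / 3 := by omega
      rw [hi, hdigit, this]
      omega
    have hg1 : π ∣ gaussSum (invMulChar τ hτ0) ψ := by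
      have h1 : gaussSum (invMulChar τ hτ0) ψ = ∑ x, invMulChar τ hτ0 x * (ψ x - 1) := by
        have h2 : ∑ x, invMulChar τ hτ0 x = 0 := by
          apply MulChar.sum_eq_zero_of_ne_one
          simpa using invMulChar_pow_ne_one (hτ0 := hτ0) hτ one_pos (by omega)
        simp only [gaussSum, mul_sub, mul_one, Finset.sum_sub_distrib, h2, sub_zero]
      rw [h1]
      exact Finset.dvd_sum fun x _ => (hπ x).mul_left _
    have hmul := jacobiSum_mul_nontrivial (χ := invMulChar τ hτ0 ^ i) (φ := invMulChar τ hτ0)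
      (by rw [← pow_succ]; exact invMulChar_pow_ne_one hτ hj0 hj) ψ
    have hJ : IsUnit (jacobiSum (invMulChar τ hτ0 ^ i) (invMulChar τ hτ0)) := by
      apply hu
      rw [res_jacobiSum_invMulChar hτ i hj, neg_ne_zero]
      intro h0
      have : ((i + 1 : ℕ) : F) = 0 := by push_cast; exact h0
      rw [CharP.cast_eq_zero_iff F 3] at this
      omega
    rw [← pow_succ] at hmul
    rw [← hJ.dvd_mul_right, hmul, hw, pow_succ]
    exact mul_dvd_mul (ih i (by omega) (by omega)) hg1

theorem exists_teichmuller_expansion [IsDomain R] [CharP F 3] (hu : ∀ x, res x ≠ 0 → IsUnit x)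
    (hτ : ∀ x, res (τ x) = x) (hτ0 : τ 0 = 0) (hπ : ∀ x, π ∣ ψ x - 1)
    (hψ : ∀ x, ψ (x ^ 3) = ψ x) (c : F) :
    ∃ e : ℕ → R, (∀ j < Fintype.card F - 1, π ^ ternaryWeight j ∣ e j) ∧
      ∀ x ≠ 0, ψ (c * x) = ∑ j ∈ Finset.range (Fintype.card F - 1), e j * τ x ^ j := by
  classical
  have hq : 1 < Fintype.card F := Fintype.one_lt_card
  by_cases hc : c = 0
  · subst hc
    refine ⟨fun j => if j = 0 then 1 else 0, fun j _ => ?_, fun x _ => ?_⟩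
    · dsimp only
      split_ifs with h
      · subst h; simp [ternaryWeight_zero]
      · exact dvd_zero _
    · simp [hq]
  have hunit : IsUnit ((Fintype.card F - 1 : ℕ) : R) := by
    apply hu
    rw [map_natCast, Nat.cast_sub hq.le, FiniteField.cast_card_eq_zero]
    simp
  obtain ⟨v, hv⟩ := hunit.exists_right_inv
  refine ⟨fun j => v * gaussSum (invMulChar τ hτ0 ^ j) ψ * τ c ^ j, fun j hj => ?_, fun x hx => ?_⟩
  · exact ((pow_ternaryWeight_dvd_gaussSum hu hτ hπ hψ j hj).mul_left _).mul_right _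
  have hinj : Function.Injective τ := Function.LeftInverse.injective hτ
  have hgeom (y : F) : ∑ j ∈ Finset.range (Fintype.card F - 1),
      (invMulChar τ hτ0 ^ j) y * τ (c * x) ^ j =
        if y = c * x then ((Fintype.card F - 1 : ℕ) : R) else 0 := by
    by_cases hy : y = 0
    · subst hy
      rw [if_neg (mul_ne_zero hc hx).symm]
      exact Finset.sum_eq_zero fun j _ => by rw [MulChar.map_zero, zero_mul]
    have hterm (j : ℕ) : (invMulChar τ hτ0 ^ j) y * τ (c * x) ^ j = τ (y⁻¹ * (c * x)) ^ j := by
      have := MulChar.pow_apply_coe (invMulChar τ hτ0) j (Units.mk0 y hy)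
      rw [Units.val_mk0] at this
      rw [this, invMulChar_apply, ← mul_pow, ← map_mul]
    simp only [hterm]
    split_ifs with h
    · subst h
      rw [inv_mul_cancel₀ hy]
      simp
    · have h1 : τ (y⁻¹ * (c * x)) ≠ 1 := by
        rw [← map_one τ, hinj.ne_iff]
        intro h2
        exact h (by rw [inv_mul_eq_one₀ hy] at h2; exact h2)
      have h2 := geom_sum_mul (τ (y⁻¹ * (c * x))) (Fintype.card F - 1)
      rw [← map_pow, FiniteField.pow_card_sub_one_eq_one _
        (mul_ne_zero (inv_ne_zero hy) (mul_ne_zero hc hx)), map_one, sub_self] at h2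
      exact (mul_eq_zero.1 h2).resolve_right (sub_ne_zero.2 h1)
  calc ψ (c * x) = ∑ y, v * ψ y * (if y = c * x then ((Fintype.card F - 1 : ℕ) : R) else 0) := by
        simp only [mul_ite, mul_zero, Finset.sum_ite_eq', Finset.mem_univ, if_true]
        linear_combination (-ψ (c * x)) * hv
    _ = ∑ y, ∑ j ∈ Finset.range (Fintype.card F - 1),
          v * ψ y * ((invMulChar τ hτ0 ^ j) y * τ (c * x) ^ j) := by
        simp only [← hgeom, Finset.mul_sum]
    _ = _ := by
        rw [Finset.sum_comm]
        refine Finset.sum_congr rfl fun j _ => ?_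
        simp only [gaussSum]
        rw [Finset.mul_sum, Finset.sum_mul, Finset.sum_mul]
        refine Finset.sum_congr rfl fun y _ => ?_
        rw [map_mul, mul_pow]
        ring

theorem sum_teichmuller_pow_eq_zero [IsDomain R] (hτ : ∀ x, res (τ x) = x) {n : ℕ}
    (hn : ¬ Fintype.card F - 1 ∣ n) : ∑ x, τ x ^ n = 0 := by
  rw [← FiniteField.forall_pow_eq_one_iff F n] at hn
  push Not at hn
  obtain ⟨a, ha⟩ := hn
  have hne : τ (a : F) ^ n ≠ 1 := by
    intro h
    have := congrArg res h
    rw [map_pow, hτ, map_one] at this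
    exact ha (Units.ext (by simpa using this))
  have h1 : ∑ x, τ x ^ n = τ a ^ n * ∑ x, τ x ^ n := by
    rw [Finset.mul_sum]
    refine (Fintype.sum_equiv (Units.mulLeft a) _ _ fun x => ?_).symm
    rw [Units.mulLeft_apply, map_mul, mul_pow]
  have h2 : (τ (a : F) ^ n - 1) * ∑ x, τ x ^ n = 0 := by linear_combination -h1
  exact (mul_eq_zero.1 h2).resolve_left (sub_ne_zero.2 hne)

theorem quadraticChar_eq_teichmuller_pow [DecidableEq F] [IsDomain R] [CharP F 3]
    (hτ : ∀ x, res (τ x) = x) (hτ0 : τ 0 = 0) (x : F) :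
    ((quadraticChar F x : ℤ) : R) = τ x ^ (Fintype.card F / 2) := by
  have h3 : (3 : F) = 0 := by exact_mod_cast CharP.cast_eq_zero F 3
  have h2 : (2 : F) ≠ 0 := by
    intro h
    exact one_ne_zero (by linear_combination h3 - h : (1 : F) = 0)
  have hF : ringChar F ≠ 2 := by rw [ringChar.eq F 3]; norm_num
  have hq : 1 < Fintype.card F := Fintype.one_lt_card
  by_cases hx : x = 0
  · subst hx
    rw [hτ0, zero_pow (by omega)]
    simp
  have hsq : (τ x ^ (Fintype.card F / 2)) * (τ x ^ (Fintype.card F / 2)) = 1 := by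
    have hodd := FiniteField.odd_card_of_char_ne_two hF
    rw [← pow_add, show Fintype.card F / 2 + Fintype.card F / 2 = Fintype.card F - 1 by omega,
      ← map_pow, FiniteField.pow_card_sub_one_eq_one _ hx, map_one]
  have hres : res (τ x ^ (Fintype.card F / 2)) = ((quadraticChar F x : ℤ) : F) := by
    rw [quadraticChar_eq_pow_of_char_ne_two' hF, map_pow, hτ]
  have hneg : (1 : F) ≠ -1 := fun h => h2 (by linear_combination h)
  rcases mul_self_eq_one_iff.1 hsq with h | h <;>
    rcases quadraticChar_dichotomy hx with h' | h' <;> rw [h, h'] at hres <;> rw [h, h'] <;>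
    simp at hres ⊢
  · exact (hneg hres).elim
  · exact (hneg hres.symm).elim

/-- Divisibility of the character sums of `a t ^ 7 + b t ^ 5 + c t` twisted by the quadratic
character. -/
theorem pow_dvd_sum_quadraticChar [DecidableEq F] [IsDomain R] [CharP F 3] {m : ℕ}
    (hcard : Fintype.card F = 3 ^ m) (hu : ∀ x, res x ≠ 0 → IsUnit x)
    (hτ : ∀ x, res (τ x) = x) (hτ0 : τ 0 = 0) (hπ : ∀ x, π ∣ ψ x - 1)
    (hψ : ∀ x, ψ (x ^ 3) = ψ x) (a b c : F) :
    π ^ m ∣ ∑ t, ((quadraticChar F t : ℤ) : R) * ψ (a * t ^ 7 + b * t ^ 5 + c * t) := by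
  have hq : 1 < Fintype.card F := Fintype.one_lt_card
  have hF : ringChar F ≠ 2 := by rw [ringChar.eq F 3]; norm_num
  have hodd := FiniteField.odd_card_of_char_ne_two hF
  obtain ⟨e, he, hea⟩ := exists_teichmuller_expansion hu hτ hτ0 hπ hψ a
  obtain ⟨f, hf, hfb⟩ := exists_teichmuller_expansion hu hτ hτ0 hπ hψ b
  obtain ⟨g, hg, hgc⟩ := exists_teichmuller_expansion hu hτ hτ0 hπ hψ c
  set s := Finset.range (Fintype.card F - 1) with hs
  have hterm (t : F) : ((quadraticChar F t : ℤ) : R) * ψ (a * t ^ 7 + b * t ^ 5 + c * t) =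
      ∑ i ∈ s, ∑ j ∈ s, ∑ k ∈ s,
        e i * f j * g k * τ t ^ (Fintype.card F / 2 + (7 * i + 5 * j + k)) := by
    by_cases ht : t = 0
    · subst ht
      rw [hτ0, MulChar.map_zero, Int.cast_zero, zero_mul]
      symm
      refine Finset.sum_eq_zero fun i _ => Finset.sum_eq_zero fun j _ =>
        Finset.sum_eq_zero fun k _ => ?_
      rw [zero_pow (by omega), mul_zero]
    rw [AddChar.map_add_eq_mul, AddChar.map_add_eq_mul, hea _ (pow_ne_zero 7 ht),
      hfb _ (pow_ne_zero 5 ht), hgc _ ht, quadraticChar_eq_teichmuller_pow hτ hτ0,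
      Finset.sum_mul_sum, Finset.sum_mul, Finset.mul_sum]
    refine Finset.sum_congr rfl fun i _ => ?_
    rw [Finset.sum_mul, Finset.mul_sum]
    refine Finset.sum_congr rfl fun j _ => ?_
    rw [Finset.mul_sum, Finset.mul_sum]
    refine Finset.sum_congr rfl fun k _ => ?_
    rw [map_pow, map_pow]
    ring
  rw [Finset.sum_congr rfl fun t _ => hterm t, Finset.sum_comm]
  refine Finset.dvd_sum fun i hi => ?_
  rw [Finset.sum_comm]
  refine Finset.dvd_sum fun j hj => ?_
  rw [Finset.sum_comm]
  refine Finset.dvd_sum fun k hk => ?_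
  rw [hs, Finset.mem_range] at hi hj hk
  rw [← Finset.mul_sum]
  by_cases hn : Fintype.card F - 1 ∣ Fintype.card F / 2 + (7 * i + 5 * j + k)
  · apply Dvd.dvd.mul_right
    obtain ⟨l, hl⟩ := hn
    obtain ⟨l, rfl⟩ : ∃ l', l = l' + 1 := by
      refine ⟨l - 1, ?_⟩
      rcases Nat.eq_zero_or_pos l with rfl | h
      · omega
      · omega
    have hw := le_ternaryWeight_add m i j k l (hcard ▸ hi) (hcard ▸ hj) (hcard ▸ hk) (by
      rw [← hcard]
      have h1 : (Fintype.card F - 1) * (l + 1) = (Fintype.card F - 1) * l + (Fintype.card F - 1) :=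
        Nat.mul_succ _ _
      have h2 : (Fintype.card F - 1) * (2 * l + 1) =
          2 * ((Fintype.card F - 1) * l) + (Fintype.card F - 1) := by ring
      omega)
    refine (pow_dvd_pow π hw).trans ?_
    rw [pow_add, pow_add]
    exact mul_dvd_mul (mul_dvd_mul (he i hi) (hf j hj)) (hg k hk)
  · rw [sum_teichmuller_pow_eq_zero hτ hn, mul_zero]
    exact dvd_zero _

end GaussSums

section SignFunctions

variable {F : Type*} [Field F] [Fintype F] [DecidableEq F]

/-- If a function `h` with values `±1` off zero is odd and has all its autocorrelations equal to
`-1`, then `{h = 1}` has the difference function of a Hadamard difference set. -/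
theorem four_mul_card_sub_eq {h : F → ℤ} (hodd : ∀ y, h (-y) = -h y) (hzero : h 0 = 0)
    (hsq : ∀ y ≠ 0, h y ^ 2 = 1) {g : F} (hg : g ≠ 0) (hcorr : ∑ z, h (z + g) * h z = -1) :
    4 * (((Finset.univ ×ˢ Finset.univ).filter
        (fun p : F × F => h p.1 = 1 ∧ h p.2 = 1 ∧ p.1 - p.2 = g)).card : ℤ) =
      Fintype.card F - 3 := by
  have hcount : ((Finset.univ ×ˢ Finset.univ).filter
      (fun p : F × F => h p.1 = 1 ∧ h p.2 = 1 ∧ p.1 - p.2 = g)).card =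
      (Finset.univ.filter (fun z : F => h (z + g) = 1 ∧ h z = 1)).card := by
    symm
    refine Finset.card_bij (fun z _ => (z + g, z)) ?_ ?_ ?_
    · intro z hz
      simpa using hz
    · intro a _ b _ hab
      exact (Prod.ext_iff.1 hab).2
    · rintro ⟨a, b⟩ hab
      simp only [Finset.mem_filter, Finset.mem_univ, true_and, Finset.mem_product] at hab
      obtain ⟨h1, h2, rfl⟩ := hab
      exact ⟨b, by simpa using ⟨h1, h2⟩, by simp⟩
  have hsq' (y : F) : h y ^ 2 = 1 - if y = 0 then 1 else 0 := by
    by_cases hy : y = 0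
    · simp [hy, hzero]
    · simp [hy, hsq y hy]
  have hind (y : F) : 2 * (if h y = 1 then 1 else 0) = h y ^ 2 + h y := by
    by_cases hy : y = 0
    · simp [hy, hzero]
    · rcases mul_self_eq_one_iff.1 ((sq _).symm.trans (hsq y hy)) with h1 | h1 <;> simp [h1]
  have hsum : ∑ z, h z = 0 := by
    have : ∑ z, h z = ∑ z, -h z := by
      refine Fintype.sum_equiv (Equiv.neg F) _ _ fun z => ?_
      rw [Equiv.neg_apply, hodd, neg_neg]
    rw [Finset.sum_neg_distrib] at this
    omega
  have hsumg : ∑ z, h (z + g) = 0 := by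
    rw [← hsum]
    exact Fintype.sum_equiv (Equiv.addRight g) _ _ fun z => rfl
  have hpoint (z : F) : 4 * (if h (z + g) = 1 ∧ h z = 1 then (1 : ℤ) else 0) =
      h (z + g) * h z + h z + h (z + g) + 1 - (if z = 0 then h g + 1 else 0) -
        (if z = -g then h (-g) + 1 else 0) := by
    have h1 : 4 * (if h (z + g) = 1 ∧ h z = 1 then (1 : ℤ) else 0) =
        (2 * (if h (z + g) = 1 then 1 else 0)) * (2 * (if h z = 1 then 1 else 0)) := by
      by_cases h1 : h (z + g) = 1 <;> by_cases h2 : h z = 1 <;> simp [h1, h2]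
    rw [h1, hind, hind, hsq', hsq']
    simp only [add_eq_zero_iff_eq_neg]
    by_cases hz : z = 0
    · subst hz
      have : (0 : F) ≠ -g := by simpa [eq_comm] using hg
      simp [hzero, this]
    · by_cases hz' : z = -g
      · subst hz'
        simp [hzero, hg]
      · simp only [hz, hz', if_false]
        ring
  rw [hcount, Finset.card_filter]
  push_cast
  rw [Finset.mul_sum, Finset.sum_congr rfl fun z _ => hpoint z]
  simp only [Finset.sum_sub_distrib, Finset.sum_add_distrib, Finset.sum_ite_eq', Finset.mem_univ,
    if_true, hcorr, hsum, hsumg, hodd, Finset.sum_const, Finset.card_univ, nsmul_eq_mul]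
  ring

theorem two_mul_card_eq {h : F → ℤ} (hodd : ∀ y, h (-y) = -h y) (hzero : h 0 = 0)
    (hsq : ∀ y ≠ 0, h y ^ 2 = 1) :
    2 * ((Finset.univ.filter (fun y : F => h y = 1)).card : ℤ) = Fintype.card F - 1 := by
  have hind (y : F) : 2 * (if h y = 1 then 1 else 0) = 1 + h y - if y = 0 then 1 else 0 := by
    by_cases hy : y = 0
    · simp [hy, hzero]
    · rcases mul_self_eq_one_iff.1 ((sq _).symm.trans (hsq y hy)) with h1 | h1 <;> simp [h1, hy]
  have hsum : ∑ z, h z = 0 := by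
    have : ∑ z, h z = ∑ z, -h z := by
      refine Fintype.sum_equiv (Equiv.neg F) _ _ fun z => ?_
      rw [Equiv.neg_apply, hodd, neg_neg]
    rw [Finset.sum_neg_distrib] at this
    omega
  rw [Finset.card_filter]
  push_cast
  rw [Finset.mul_sum, Finset.sum_congr rfl fun z _ => hind z]
  simp [Finset.sum_sub_distrib, Finset.sum_add_distrib, hsum]

variable {R : Type*} [CommRing R] [IsDomain R]

theorem sum_mul_fourier_eq (ψ : AddChar F R) (hψ : ψ.IsPrimitive) (h : F → R) (g : F) :
    ∑ b, (∑ y, h y * ψ (b * y)) * (∑ z, h z * ψ (-b * z)) * ψ (-b * g) =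
      Fintype.card F * ∑ z, h (z + g) * h z := by
  have h1 (b : F) : (∑ y, h y * ψ (b * y)) * (∑ z, h z * ψ (-b * z)) * ψ (-b * g) =
      ∑ z, ∑ y, h y * h z * ψ (b * (y - (z + g))) := by
    rw [Finset.sum_mul_sum, Finset.sum_comm, Finset.sum_mul]
    refine Finset.sum_congr rfl fun z _ => ?_
    rw [Finset.sum_mul]
    refine Finset.sum_congr rfl fun y _ => ?_
    rw [show b * (y - (z + g)) = b * y + -b * z + -b * g by ring, AddChar.map_add_eq_mul,
      AddChar.map_add_eq_mul]
    ring
  rw [Finset.sum_congr rfl fun b _ => h1 b, Finset.sum_comm, Finset.mul_sum]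
  refine Finset.sum_congr rfl fun z _ => ?_
  rw [Finset.sum_comm]
  have h2 (y : F) : ∑ b, h y * h z * ψ (b * (y - (z + g))) =
      if y = z + g then Fintype.card F * (h y * h z) else 0 := by
    rw [← Finset.mul_sum, AddChar.sum_mulShift _ hψ]
    simp only [sub_eq_zero]
    split_ifs
    · ring
    · simp
  rw [Finset.sum_congr rfl fun y _ => h2 y]
  simp

theorem pow_three_dvd_of_cast {E : Type*} [Field E] [CharP E 3] [CharZero R] (res : R →+* E)
    (k : ℕ) (n : ℤ) (h : (3 : R) ^ k ∣ n) : (3 : ℤ) ^ k ∣ n := by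
  induction k with
  | zero => simp
  | succ k ih =>
    obtain ⟨l, rfl⟩ := ih ((pow_dvd_pow _ k.le_succ).trans h)
    obtain ⟨r, hr⟩ := h
    have h1 : (l : R) = 3 * r := by
      apply mul_left_cancel₀ (pow_ne_zero k (OfNat.ofNat_ne_zero 3 : (3 : R) ≠ 0))
      push_cast at hr
      rw [hr]; ring
    have h3 : (3 : E) = 0 := by exact_mod_cast CharP.cast_eq_zero E 3
    have h2 := congrArg res h1
    rw [map_intCast, map_mul, map_ofNat, h3, zero_mul, CharP.intCast_eq_zero_iff E 3] at h2
    rw [pow_succ]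
    exact mul_dvd_mul_left _ h2

theorem odd_sum_fiber {E : Type*} [Field E] [Fintype E] {h : E → ℤ} (hsq : ∀ y ≠ 0, h y ^ 2 = 1)
    (hq : Odd (Fintype.card E)) (f : E →+ ZMod 3) (hf : ∃ y, f y ≠ 0) :
    Odd (∑ y, if f y = 1 then h y else 0) := by
  obtain ⟨y₀, hy₀⟩ := hf
  have hsurj (c : ZMod 3) : c ∈ Set.range f := by
    have : c = 0 ∨ c = f y₀ ∨ c = f (-y₀) := by
      rw [map_neg]
      generalize f y₀ = a at hy₀
      revert a c
      decide
    rcases this with rfl | rfl | rfl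
    · exact ⟨0, map_zero f⟩
    · exact ⟨_, rfl⟩
    · exact ⟨_, rfl⟩
  have hcard : Fintype.card E = 3 * (Finset.univ.filter (fun y => f y = 1)).card := by
    rw [← Finset.card_univ, Finset.card_eq_sum_card_fiberwise (f := f) (t := Finset.univ)
      (fun _ _ => Finset.mem_coe.2 (Finset.mem_univ _))]
    rw [Finset.sum_congr rfl fun c _ =>
      AddMonoidHom.card_fiber_eq_of_mem_range f (hsurj c) (hsurj 1)]
    simp
  have hodd : Odd (Finset.univ.filter (fun y => f y = 1)).card := by
    rw [hcard] at hq
    exact (Nat.odd_mul.1 hq).2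
  rw [← ZMod.intCast_eq_one_iff_odd]
  rw [← ZMod.natCast_eq_one_iff_odd] at hodd
  rw [← hodd, Finset.card_filter]
  push_cast
  refine Finset.sum_congr rfl fun y _ => ?_
  split_ifs with hy
  · have hy0 : y ≠ 0 := by
      rintro rfl
      rw [map_zero] at hy
      exact absurd hy (by decide)
    rcases mul_self_eq_one_iff.1 ((sq _).symm.trans (hsq y hy0)) with h1 | h1 <;> rw [h1] <;> decide
  · rfl

/-- An odd function with values `±1` off zero, whose Fourier coefficients with respect to the
character `x ↦ ω ^ f x` are divisible by `(ω - 1) ^ m`, has all autocorrelations equal to `-1`. -/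
theorem autocorrelation_eq_neg_one [CharP F 3] [CharZero R] {res : R →+* F} {ω : R}
    (hω : ω ^ 2 + ω + 1 = 0) {m : ℕ} (hm : Odd m)
    (hcard : Fintype.card F = 3 ^ m) {h : F → ℤ} (hodd : ∀ y, h (-y) = -h y) (hzero : h 0 = 0)
    (hsq : ∀ y ≠ 0, h y ^ 2 = 1) (f : F →+ ZMod 3) (hf : ∀ b ≠ 0, ∃ y, f (b * y) ≠ 0)
    {ψ : AddChar F R} (hψ : ψ.IsPrimitive) (hψf : ∀ x, ψ x = ω ^ (f x).val)
    (hdvd : ∀ b ≠ 0, (ω - 1) ^ m ∣ ∑ y, (h y : R) * ψ (b * y)) {g : F} (hg : g ≠ 0) :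
    ∑ z, h (z + g) * h z = -1 := by
  obtain ⟨k, rfl⟩ := hm
  have hω3 : ω ^ 3 = 1 := by linear_combination (ω - 1) * hω
  have hπ : ω - 1 ≠ 0 := by
    intro h0
    have : (3 : R) = 0 := by linear_combination hω - (ω + 2) * h0
    exact OfNat.ofNat_ne_zero 3 this
  set N : ZMod 3 → F → ℤ := fun c b => ∑ y, if f (b * y) = c then h y else 0 with hN
  have hNneg (c : ZMod 3) (b : F) : N (-c) b = -N c b := by
    rw [hN]
    dsimp only
    rw [← Finset.sum_neg_distrib]
    refine Fintype.sum_equiv (Equiv.neg F) _ _ fun y => ?_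
    rw [Equiv.neg_apply, hodd, mul_neg, map_neg]
    simp only [neg_eq_iff_eq_neg]
    split_ifs <;> simp
  have hS (b : F) : ∑ y, (h y : R) * ψ (b * y) = N 1 b * (ω - ω ^ 2) := by
    have h0 : N 0 b = 0 := by
      have := hNneg 0 b
      rw [neg_zero] at this
      omega
    have h2 : N 2 b = -N 1 b := hNneg 1 b
    have hsplit : ∑ y, (h y : R) * ψ (b * y) = N 0 b + N 1 b * ω + N 2 b * ω ^ 2 := by
      simp only [hN, Int.cast_sum, Finset.sum_mul]
      rw [← Finset.sum_add_distrib, ← Finset.sum_add_distrib]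
      refine Finset.sum_congr rfl fun y _ => ?_
      rw [hψf]
      generalize f (b * y) = c
      have : c = 0 ∨ c = 1 ∨ c = 2 := by revert c; decide
      rcases this with rfl | rfl | rfl
      · simp [show (0 : ZMod 3) ≠ 1 by decide, show (0 : ZMod 3) ≠ 2 by decide]
      · simp [show (1 : ZMod 3) ≠ 2 by decide, ZMod.val_one]
      · simp [show (2 : ZMod 3) ≠ 1 by decide, show (2 : ZMod 3) ≠ 0 by decide,
          show (2 : ZMod 3).val = 2 from rfl]
    rw [hsplit, h0, h2]
    push_cast
    ring
  have hodd_card : Odd (Fintype.card F) := by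
    rw [hcard]
    exact Odd.pow (by decide)
  have hle (b : F) (hb : b ≠ 0) : (3 : ℤ) ^ (2 * k) ≤ N 1 b ^ 2 := by
    have h1 : Odd (N 1 b) := odd_sum_fiber hsq hodd_card (f.comp (AddMonoidHom.mulLeft b)) (hf b hb)
    have h2 : (3 : ℤ) ^ k ∣ N 1 b := by
      apply pow_three_dvd_of_cast res
      have h3 := hdvd b hb
      rw [hS, show (N 1 b : R) * (ω - ω ^ 2) = (ω - 1) * (-ω * N 1 b) by ring, pow_succ',
        mul_dvd_mul_iff_left hπ, pow_mul,
        show (ω - 1) ^ 2 = 3 * (-ω) by linear_combination hω, mul_pow] at h3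
      have h4 := (dvd_of_mul_right_dvd h3).mul_left (-ω ^ 2)
      rwa [show -ω ^ 2 * (-ω * (N 1 b : R)) = ω ^ 3 * N 1 b by ring, hω3, one_mul] at h4
    have h3 : N 1 b ≠ 0 := by
      intro h0
      rw [h0] at h1
      exact absurd h1 (by decide)
    have h4 : (3 : ℤ) ^ k ≤ |N 1 b| := Int.le_of_dvd (abs_pos.2 h3) ((dvd_abs _ _).2 h2)
    rw [mul_comm, pow_mul, ← sq_abs (N 1 b)]
    exact pow_le_pow_left₀ (by positivity) h4 2
  have hfour (g : F) : ∑ b, (3 * N 1 b ^ 2 : R) * ψ (-b * g) =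
      Fintype.card F * ∑ z, (h (z + g) : R) * h z := by
    rw [← sum_mul_fourier_eq ψ hψ (fun y => (h y : R)) g]
    refine Finset.sum_congr rfl fun b _ => ?_
    have hneg : N 1 (-b) = -N 1 b := by
      rw [← hNneg]
      simp only [hN, neg_mul, map_neg, neg_eq_iff_eq_neg]
    rw [hS, hS, hneg]
    push_cast
    linear_combination ((N 1 b : R) ^ 2 * ψ (-b * g) * (ω ^ 2 - 3 * ω + 3)) * hω
  have hN0 : N 1 0 = 0 := by
    simp [hN, show (0 : ZMod 3) ≠ 1 by decide]
  have hpars : ∑ b, 3 * N 1 b ^ 2 = ∑ b : F, if b = 0 then 0 else (3 : ℤ) ^ (2 * k + 1) := by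
    have h1 := hfour 0
    simp only [mul_zero, AddChar.map_zero_eq_one, mul_one, add_zero] at h1
    have h2 : ∑ z, h z * h z = ∑ z : F, if z = 0 then 0 else (1 : ℤ) := by
      refine Finset.sum_congr rfl fun z _ => ?_
      split_ifs with hz
      · simp [hz, hzero]
      · rw [← sq, hsq z hz]
    have h3 : ∑ b, 3 * N 1 b ^ 2 = (Fintype.card F : ℤ) * ∑ z, h z * h z := by
      exact_mod_cast h1
    rw [h3, h2, hcard, Finset.mul_sum]
    push_cast
    simp
  have heq : ∀ b, 3 * N 1 b ^ 2 = if b = 0 then 0 else (3 : ℤ) ^ (2 * k + 1) := by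
    have := (Finset.sum_eq_sum_iff_of_le (s := Finset.univ)
      (f := fun b : F => if b = 0 then 0 else (3 : ℤ) ^ (2 * k + 1))
      (g := fun b => 3 * N 1 b ^ 2) (fun b _ => ?_)).1 hpars.symm
    · exact fun b => (this b (Finset.mem_univ b)).symm
    · split_ifs with hb
      · positivity
      · rw [pow_succ']
        exact mul_le_mul_of_nonneg_left (hle b hb) (by norm_num)
  have hq0 : (Fintype.card F : R) ≠ 0 := Nat.cast_ne_zero.2 Fintype.card_ne_zero
  have hfin : ((∑ z, h (z + g) * h z : ℤ) : R) = ((-1 : ℤ) : R) := by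
    apply mul_left_cancel₀ hq0
    push_cast
    rw [← hfour g]
    have h1 (b : F) : (3 * N 1 b ^ 2 : R) * ψ (-b * g) =
        Fintype.card F * ψ (b * -g) - if b = 0 then (Fintype.card F : R) else 0 := by
      have h2 : (3 * N 1 b ^ 2 : R) = ((3 * N 1 b ^ 2 : ℤ) : R) := by push_cast; ring
      rw [h2, heq, neg_mul_comm, hcard]
      split_ifs with hb
      · simp [hb]
      · push_cast; ring
    rw [Finset.sum_congr rfl fun b _ => h1 b, Finset.sum_sub_distrib, ← Finset.mul_sum,
      AddChar.sum_mulShift _ hψ, if_neg (neg_ne_zero.2 hg)]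
    simp
  exact_mod_cast hfin

end SignFunctions

section DicksonPermutation

theorem eq_one_of_pow_seven_eq_one {K : Type*} [Field K] {ζ : K} {m : ℕ} (hm : ¬ 3 ∣ m)
    (h7 : ζ ^ 7 = 1) (h9 : ζ ^ 9 ^ m = ζ) : ζ = 1 := by
  have hζ : ζ ≠ 0 := by
    rintro rfl
    simp at h7
  have hmod : 9 ^ m % 7 = 2 ∨ 9 ^ m % 7 = 4 := by
    obtain ⟨k, hk⟩ : ∃ k, m = 3 * k + 1 ∨ m = 3 * k + 2 := ⟨m / 3, by omega⟩
    rcases hk with rfl | rfl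
    · left; simp [pow_add, pow_mul, Nat.mul_mod, Nat.pow_mod]
    · right; simp [pow_add, pow_mul, Nat.mul_mod, Nat.pow_mod]
  rw [pow_eq_pow_mod _ h7] at h9
  rcases hmod with h | h <;> rw [h] at h9
  · apply mul_left_cancel₀ hζ
    linear_combination h9
  · have h3 : ζ ^ 3 = 1 := by
      apply mul_left_cancel₀ hζ
      linear_combination h9
    linear_combination h7 - (ζ ^ 4 + ζ) * h3

theorem pow_nine_pow_eq_self {K : Type*} [Field K] [CharP K 3] {m : ℕ} {a v : K}
    (hsum : (a + v) ^ 3 ^ m = a + v) (hprod : (a * v) ^ 3 ^ m = a * v) : a ^ 9 ^ m = a := by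
  rw [add_pow_char_pow] at hsum
  rw [mul_pow] at hprod
  have h9 : a ^ 9 ^ m = (a ^ 3 ^ m) ^ 3 ^ m := by
    rw [← pow_mul, ← mul_pow]
    norm_num
  have h : (a ^ 3 ^ m - a) * (a ^ 3 ^ m - v) = 0 := by
    linear_combination a ^ 3 ^ m * hsum - hprod
  rw [h9]
  rcases mul_eq_zero.1 h with h | h
  · rw [sub_eq_zero.1 h, sub_eq_zero.1 h]
  · rw [sub_eq_zero.1 h]
    linear_combination hsum - h

theorem dickson_seven_add_eq {K : Type*} [Field K] [CharP K 3] (a v : K) :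
    (a + v) ^ 7 - a * v * (a + v) ^ 5 - (a * v) ^ 2 * (a + v) ^ 3 - (a * v) ^ 3 * (a + v) =
      a ^ 7 + v ^ 7 := by
  have h3 : (3 : K) = 0 := by exact_mod_cast CharP.cast_eq_zero K 3
  linear_combination (2 * a ^ 6 * v + 5 * a ^ 5 * v ^ 2 + 7 * a ^ 4 * v ^ 3 + 7 * a ^ 3 * v ^ 4 +
    5 * a ^ 2 * v ^ 5 + 2 * a * v ^ 6) * h3

theorem eq_of_pow_seven_eq {K : Type*} [Field K] [CharP K 3] {m : ℕ} (hm : ¬ 3 ∣ m) {u a v b w : K}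
    (hu : u ≠ 0) (hu' : u ^ 3 ^ m = u) (hav : a * v = u) (hbw : b * w = u)
    (hs : (a + v) ^ 3 ^ m = a + v) (ht : (b + w) ^ 3 ^ m = b + w) (h : a ^ 7 = b ^ 7) :
    a + v = b + w := by
  have hb : b ≠ 0 := left_ne_zero_of_mul (hbw.trans_ne hu)
  have ha9 := pow_nine_pow_eq_self hs (by rw [hav, hu'])
  have hb9 := pow_nine_pow_eq_self ht (by rw [hbw, hu'])
  have hab : a = b := (div_eq_one_iff_eq hb).1 <| eq_one_of_pow_seven_eq_one hm
    (by rw [div_pow, h, div_self (pow_ne_zero _ hb)]) (by rw [div_pow, ha9, hb9])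
  subst hab
  rw [mul_left_cancel₀ hb (hav.trans hbw.symm)]

theorem exists_add_eq_mul_eq {K : Type*} [Field K] [IsAlgClosed K] (s u : K) :
    ∃ a v : K, a + v = s ∧ a * v = u := by
  obtain ⟨a, ha⟩ := IsAlgClosed.exists_root
    (Polynomial.X ^ 2 - Polynomial.C s * Polynomial.X + Polynomial.C u)
    (by
      have : (Polynomial.X ^ 2 - Polynomial.C s * Polynomial.X + Polynomial.C u).degree = 2 := by
        compute_degree!
      rw [this]; decide)
  refine ⟨a, s - a, by ring, ?_⟩
  simp only [Polynomial.IsRoot.def, Polynomial.eval_add, Polynomial.eval_sub, Polynomial.eval_pow,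
    Polynomial.eval_mul, Polynomial.eval_X, Polynomial.eval_C] at ha
  linear_combination -ha

/-- The Dickson polynomial of order seven permutes the field with `3 ^ m` elements
if `3 ∤ m`. -/
theorem dickson_seven_injective {F : Type*} [Field F] [Fintype F] [CharP F 3] {m : ℕ}
    (hm : ¬ 3 ∣ m) (hcard : Fintype.card F = 3 ^ m) {u : F} (hu : u ≠ 0) :
    Function.Injective (fun t : F => t ^ 7 - u * t ^ 5 - u ^ 2 * t ^ 3 - u ^ 3 * t) := by
  intro s t hst
  let K := AlgebraicClosure F
  let φ : F →+* K := algebraMap F K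
  have : CharP K 3 := charP_of_injective_algebraMap φ.injective 3
  have hfix (x : F) : φ x ^ 3 ^ m = φ x := by
    rw [← map_pow, ← hcard, FiniteField.pow_card]
  obtain ⟨a, v, hs, hav⟩ := exists_add_eq_mul_eq (φ s) (φ u)
  obtain ⟨b, w, ht, hbw⟩ := exists_add_eq_mul_eq (φ t) (φ u)
  have hu' : φ u ≠ 0 := (map_ne_zero φ).2 hu
  have h : a ^ 7 + v ^ 7 = b ^ 7 + w ^ 7 := by
    rw [← dickson_seven_add_eq, ← dickson_seven_add_eq, hs, ht, hav, hbw]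
    simpa using congrArg φ hst
  have hprod : (a ^ 7 - b ^ 7) * (a ^ 7 - w ^ 7) = 0 := by
    have h1 : a ^ 7 * v ^ 7 = b ^ 7 * w ^ 7 := by
      rw [← mul_pow, ← mul_pow, hav, hbw]
    linear_combination a ^ 7 * h - h1
  apply φ.injective
  rcases mul_eq_zero.1 hprod with h7 | h7
  · rw [← hs, ← ht]
    exact eq_of_pow_seven_eq hm hu' (hfix u) hav hbw (by rw [hs, hfix]) (by rw [ht, hfix])
      (sub_eq_zero.1 h7)
  · rw [← hs, ← ht, add_comm b]
    exact eq_of_pow_seven_eq hm hu' (hfix u) hav (by rw [mul_comm, hbw]) (by rw [hs, hfix])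
      (by rw [add_comm, ht, hfix]) (sub_eq_zero.1 h7)

end DicksonPermutation

section TraceCharacter

variable {F : Type*} [Field F] [Fintype F] [Algebra (ZMod 3) F]

theorem trace_pow_three (x : F) :
    Algebra.trace (ZMod 3) F (x ^ 3) = Algebra.trace (ZMod 3) F x := by
  have h := Algebra.trace_eq_of_algEquiv
    (FiniteField.frobeniusAlgEquivOfAlgebraic (ZMod 3) F) x
  simpa using h

theorem exists_trace_mul_ne_zero {b : F} (hb : b ≠ 0) :
    ∃ y, Algebra.trace (ZMod 3) F (b * y) ≠ 0 := by
  have : Module.Finite (ZMod 3) F := Module.Finite.of_finite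
  by_contra! h
  exact hb ((traceForm_nondegenerate (ZMod 3) F).1 b fun y => by
    simpa [Algebra.traceForm_apply] using h y)

variable {R : Type*} [CommRing R] {ω : R}

/-- The canonical additive character of a finite field of characteristic three, with values the
powers of a given cube root of unity. -/
noncomputable def traceChar (F : Type*) [Field F] [Algebra (ZMod 3) F] (hω : ω ^ 3 = 1) :
    AddChar F R :=
  (AddChar.zmodChar 3 hω).compAddMonoidHom (Algebra.trace (ZMod 3) F).toAddMonoidHom

theorem traceChar_apply {F R : Type*} [Field F] [Algebra (ZMod 3) F] [CommRing R] {ω : R}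
    (hω : ω ^ 3 = 1) (x : F) :
    traceChar F hω x = ω ^ (Algebra.trace (ZMod 3) F x).val := rfl

theorem traceChar_isPrimitive (hω : ω ^ 3 = 1) (hω1 : ω ≠ 1) :
    (traceChar F hω).IsPrimitive := by
  intro b hb h
  obtain ⟨y, hy⟩ := exists_trace_mul_ne_zero hb
  have h1 : ω ^ (Algebra.trace (ZMod 3) F (b * y)).val = 1 := by
    rw [← traceChar_apply hω, ← AddChar.mulShift_apply, h, AddChar.one_apply]
  generalize Algebra.trace (ZMod 3) F (b * y) = c at hy h1
  have : c = 1 ∨ c = 2 := by clear h1; revert c; decide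
  rcases this with rfl | rfl
  · exact hω1 (by simpa [ZMod.val_one] using h1)
  · rw [show (2 : ZMod 3).val = 2 from rfl] at h1
    exact hω1 (by linear_combination hω - ω * h1)

theorem traceChar_pow_three (hω : ω ^ 3 = 1) (x : F) :
    traceChar F hω (x ^ 3) = traceChar F hω x := by
  rw [traceChar_apply, traceChar_apply, trace_pow_three]

theorem sub_one_dvd_traceChar_sub_one {F : Type*} [Field F] [Algebra (ZMod 3) F]
    (hω : ω ^ 3 = 1) (x : F) :
    ω - 1 ∣ traceChar F hω x - 1 := by
  rw [traceChar_apply]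
  exact sub_one_dvd_pow_sub_one ω _

end TraceCharacter

section DicksonSign

variable {F : Type*} [Field F] [Fintype F] [DecidableEq F]

theorem sum_dickson_eq [CharP F 3] {R : Type*} [CommRing R] {ψ : AddChar F R}
    (hψ : ∀ x, ψ (x ^ 3) = ψ x) (u b : F) :
    ∃ c : F, ∑ t, ((quadraticChar F t : ℤ) : R) *
        ψ (b * (t ^ 7 - u * t ^ 5 - u ^ 2 * t ^ 3 - u ^ 3 * t)) =
      ∑ t, ((quadraticChar F t : ℤ) : R) * ψ (b * t ^ 7 + (-b * u) * t ^ 5 + c * t) := by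
  obtain ⟨r, hr⟩ : ∃ r : F, r ^ 3 = b * u ^ 2 := (bijective_frobenius F 3).surjective _
  refine ⟨-r - b * u ^ 3, Finset.sum_congr rfl fun t _ => ?_⟩
  congr 1
  rw [show b * (t ^ 7 - u * t ^ 5 - u ^ 2 * t ^ 3 - u ^ 3 * t) =
    (b * t ^ 7 + -b * u * t ^ 5 - b * u ^ 3 * t) + (-r * t) ^ 3 by
      linear_combination t ^ 3 * hr, AddChar.map_add_eq_mul, hψ, ← AddChar.map_add_eq_mul]
  congr 1
  ring

theorem quadraticChar_neg_eq {m : ℕ} (hm : Odd m) (hcard : Fintype.card F = 3 ^ m) (t : F) :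
    quadraticChar F (-t) = -quadraticChar F t := by
  have hmod : 3 ^ m % 4 = 3 := by
    obtain ⟨k, rfl⟩ := hm
    simp [pow_succ, pow_mul, Nat.mul_mod, Nat.pow_mod]
  have h1 : quadraticChar F (-1) = -1 := by
    rw [quadraticChar_neg_one_iff_not_isSquare, FiniteField.isSquare_neg_one_iff, hcard]
    exact fun h => h hmod
  rw [neg_eq_neg_one_mul, map_mul, h1, neg_one_mul]

theorem quadraticChar_autocorrelation_eq_neg_one [CharP F 3] {m : ℕ} (hm : Odd m)
    (hcard : Fintype.card F = 3 ^ m) {u : F} (e : F ≃ F)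
    (he : ∀ t, e t = t ^ 7 - u * t ^ 5 - u ^ 2 * t ^ 3 - u ^ 3 * t)
    (hodd : ∀ y, quadraticChar F (e.symm (-y)) = -quadraticChar F (e.symm y))
    (hzero : quadraticChar F (e.symm 0) = 0)
    (hsq : ∀ y ≠ 0, quadraticChar F (e.symm y) ^ 2 = 1) {g : F} (hg : g ≠ 0) :
    ∑ z, quadraticChar F (e.symm (z + g)) * quadraticChar F (e.symm z) = -1 := by
  obtain ⟨R, _, _, _, res, τ, ω, hunit, hτ, hτ0, hω⟩ := exists_domain_teichmuller_cube_root F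
  let _ : Algebra (ZMod 3) F := ZMod.algebra F 3
  have hω3 : ω ^ 3 = 1 := by linear_combination (ω - 1) * hω
  have hω1 : ω ≠ 1 := by
    rintro rfl
    exact OfNat.ofNat_ne_zero (R := R) 3 (by linear_combination hω)
  refine autocorrelation_eq_neg_one (res := res) hω hm hcard
    (h := fun y => quadraticChar F (e.symm y)) hodd hzero hsq
    (Algebra.trace (ZMod 3) F).toAddMonoidHom (fun b hb => exists_trace_mul_ne_zero hb)
    (traceChar_isPrimitive hω3 hω1) (traceChar_apply hω3) (fun b _ => ?_) hg
  rw [← e.sum_comp]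
  simp only [Equiv.symm_apply_apply]
  simp only [he]
  obtain ⟨c, hc⟩ := sum_dickson_eq (traceChar_pow_three hω3) u b
  rw [hc]
  exact pow_dvd_sum_quadraticChar hcard hunit hτ hτ0 (sub_one_dvd_traceChar_sub_one hω3)
    (traceChar_pow_three hω3) _ _ _

end DicksonSign

/-- **Main theorem.** For `q = 3^m` with `m` odd and `3 ∤ m`, and `u ≠ 0` in `GF(q)`,
the set `D_u = {D_7(x², u) : x ≠ 0}` is a skew Hadamard difference set in `(GF(q), +)`:
it is skew, has `(q-1)/2` elements, and every nonzero `g` has exactly `(q-3)/4`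
representations as a difference of two elements of `D_u`. -/
theorem dickson7_image_skew_hadamard_difference_set
    (m : ℕ) (hm : Odd m) (hm3 : ¬ (3 ∣ m)) (F : Type*) [Field F] [Fintype F]
    [DecidableEq F] (hcard : Fintype.card F = 3 ^ m) (u : F) (hu : u ≠ 0) :
    let Du : Finset F := (Finset.univ.filter (fun x : F => x ≠ 0)).image
      (fun x => (x ^ 2) ^ 7 - u * (x ^ 2) ^ 5 - u ^ 2 * (x ^ 2) ^ 3 - u ^ 3 * x ^ 2)
    (Du ∩ Du.image (fun d => -d) = ∅) ∧
    (Du ∪ Du.image (fun d => -d) ∪ {0} = Finset.univ) ∧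
    Du.card = (3 ^ m - 1) / 2 ∧
    (∀ g : F, g ≠ 0 →
      ((Finset.univ ×ˢ Finset.univ).filter
        (fun p : F × F => p.1 ∈ Du ∧ p.2 ∈ Du ∧ p.1 - p.2 = g)).card =
      (3 ^ m - 3) / 4) := by
  intro Du
  have : CharP F 3 := by
    have : Fact (Nat.Prime 3) := ⟨Nat.prime_three⟩
    exact charP_of_card_eq_prime_pow (by rw [← hcard])
  let e : F ≃ F := Equiv.ofBijective _
    (Finite.injective_iff_bijective.1 (dickson_seven_injective hm3 hcard hu))
  have he (t : F) : e t = t ^ 7 - u * t ^ 5 - u ^ 2 * t ^ 3 - u ^ 3 * t := rfl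
  have hneg (y : F) : e.symm (-y) = -e.symm y := by
    rw [Equiv.symm_apply_eq]
    calc -y = -e (e.symm y) := by rw [e.apply_symm_apply]
      _ = e (-e.symm y) := by rw [he, he]; ring
  have hz : e.symm 0 = 0 := by
    rw [Equiv.symm_apply_eq, he]
    ring
  set h : F → ℤ := fun y => quadraticChar F (e.symm y) with hh
  have hodd (y : F) : h (-y) = -h y := by
    simp only [hh, hneg, quadraticChar_neg_eq hm hcard]
  have hzero : h 0 = 0 := by
    simp [hh, hz]
  have hne {y : F} (hy : y ≠ 0) : e.symm y ≠ 0 := by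
    rwa [← hz, e.symm.injective.ne_iff]
  have hsq (y : F) (hy : y ≠ 0) : h y ^ 2 = 1 := quadraticChar_sq_one (hne hy)
  have hmem (y : F) : y ∈ Du ↔ h y = 1 := by
    simp only [Du, Finset.mem_image, Finset.mem_filter, Finset.mem_univ, true_and]
    constructor
    · rintro ⟨x, hx, rfl⟩
      rw [← he]
      simp only [hh, Equiv.symm_apply_apply]
      exact quadraticChar_sq_one' hx
    · intro hy
      have hy0 : e.symm y ≠ 0 := by
        intro h0
        simp [hh, h0] at hy
      obtain ⟨x, hx⟩ := (quadraticChar_one_iff_isSquare hy0).1 hy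
      refine ⟨x, ?_, ?_⟩
      · rintro rfl
        exact hy0 (by simpa using hx)
      · rw [← he, sq, ← hx, e.apply_symm_apply]
  have hmem_neg (y : F) : y ∈ Du.image (fun d => -d) ↔ h y = -1 := by
    simp only [Finset.mem_image, hmem]
    constructor
    · rintro ⟨d, hd, rfl⟩
      rw [hodd, hd]
    · intro hy
      exact ⟨-y, by rw [hodd, hy, neg_neg], neg_neg y⟩
  refine ⟨?_, ?_, ?_, fun g hg => ?_⟩
  · ext y
    simp only [Finset.mem_inter, hmem, hmem_neg, Finset.notMem_empty, iff_false]
    omega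
  · ext y
    simp only [Finset.mem_union, hmem, hmem_neg, Finset.mem_singleton, Finset.mem_univ, iff_true]
    by_cases hy : y = 0
    · exact Or.inr hy
    · exact Or.inl (mul_self_eq_one_iff.1 ((sq _).symm.trans (hsq y hy)))
  · have h1 := two_mul_card_eq hodd hzero hsq
    rw [show Du = Finset.univ.filter (fun y => h y = 1) by ext y; simp [hmem]]
    rw [hcard] at h1
    omega
  · have h1 := four_mul_card_sub_eq hodd hzero hsq hg
      (quadraticChar_autocorrelation_eq_neg_one hm hcard e he hodd hzero hsq hg)
    simp only [hmem]
    rw [hcard] at h1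
    omega
end

section
/- Let G be an abelian group of order p^m, where p is a prime congruent to 3 modulo 4 and m is an odd integer. Let D be a subset of G such that D ∩ (−D) = ∅ and D ∪ (−D) ∪ {0} = G, and such that tD = D for every nonzero quadratic residue t modulo p (where tD = {t·d : d ∈ D} with t·d the t-fold sum of d). If for every nontrivial additive character ψ: G → ℂ^* the quantity (ψ(D) − (p^{(m−1)/2} − 1)/2) / p^{(m−1)/2} is an algebraic integer, where ψ(D) = Σ_{d∈D} ψ(d), then D is a (p^m, (p^m−1)/2, (p^m−3)/4) difference set in G, i.e., every nonzero g ∈ G has exactly (p^m−3)/4 representations g = d₁ − d₂ with d₁, d₂ ∈ D. -/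
open Finset

/-- The sum of all powers of an `N`-th root of unity is a rational integer. -/
lemma geom_sum_mem_range_intCast {N : ℕ} {η : ℂ} (hη : η ^ N = 1) :
    ∑ t ∈ range N, η ^ t ∈ (Int.castRingHom ℂ).range := by
  by_cases h : η = 1
  · exact ⟨N, by simp [h]⟩
  · rw [geom_sum_eq h, hη]
    simp

/-- The quadratic character modulo `p` with complex values. -/
noncomputable def complexQuadraticChar (p : ℕ) [Fact p.Prime] : MulChar (ZMod p) ℂ :=
  (quadraticChar (ZMod p)).ringHomComp (Int.castRingHom ℂ)

section QuadraticChar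

variable {p : ℕ} [Fact p.Prime]

lemma complexQuadraticChar_apply (a : ZMod p) :
    complexQuadraticChar p a = (quadraticChar (ZMod p) a : ℂ) := rfl

lemma complexQuadraticChar_isQuadratic : (complexQuadraticChar p).IsQuadratic :=
  MulChar.IsQuadratic.comp (quadraticChar_isQuadratic _) _

lemma ringChar_ne_two_of_mod_four (hp4 : p % 4 = 3) : ringChar (ZMod p) ≠ 2 := by
  rw [ZMod.ringChar_zmod_n]
  rintro rfl
  omega

lemma complexQuadraticChar_ne_one (hp4 : p % 4 = 3) : complexQuadraticChar p ≠ 1 :=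
  (MulChar.ringHomComp_ne_one_iff Int.cast_injective).2
    (quadraticChar_ne_one (ringChar_ne_two_of_mod_four hp4))

lemma quadraticChar_neg_one_of_mod_four (hp4 : p % 4 = 3) :
    quadraticChar (ZMod p) (-1) = -1 := by
  rw [quadraticChar_neg_one (ringChar_ne_two_of_mod_four hp4), ZMod.card,
    ZMod.χ₄_nat_three_mod_four hp4]

/-- The quadratic Gauss sum modulo `p`. -/
noncomputable def quadraticGaussSum (p : ℕ) [Fact p.Prime] : ℂ :=
  gaussSum (complexQuadraticChar p) ZMod.stdAddChar

lemma quadraticGaussSum_sq (hp4 : p % 4 = 3) : quadraticGaussSum p ^ 2 = -p := by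
  rw [quadraticGaussSum, gaussSum_sq (χ := complexQuadraticChar p) (complexQuadraticChar_ne_one hp4)
    complexQuadraticChar_isQuadratic (ZMod.isPrimitive_stdAddChar p), complexQuadraticChar_apply,
    quadraticChar_neg_one_of_mod_four hp4]
  simp

lemma sum_complexQuadraticChar_mul_pow (hp4 : p % 4 = 3) (t : ℕ) :
    ∑ a : ZMod p, complexQuadraticChar p a * (ZMod.stdAddChar a : ℂ) ^ t =
      complexQuadraticChar p t * quadraticGaussSum p := by
  by_cases ht : (t : ZMod p) = 0
  · rw [ht, MulChar.map_zero, zero_mul, ← MulChar.sum_eq_zero_of_ne_one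
      (complexQuadraticChar_ne_one hp4)]
    refine sum_congr rfl fun a _ => ?_
    rw [← AddChar.map_nsmul_eq_pow, nsmul_eq_mul, ht, zero_mul, AddChar.map_zero_eq_one, mul_one]
  · have h := gaussSum_mulShift (complexQuadraticChar p) ZMod.stdAddChar (Units.mk0 _ ht)
    rw [quadraticGaussSum, ← h, ← mul_assoc, Units.val_mk0, ← pow_two, complexQuadraticChar_apply]
    norm_cast
    rw [quadraticChar_sq_one ht, Int.cast_one, one_mul, gaussSum]
    refine sum_congr rfl fun a _ => ?_
    rw [AddChar.mulShift_apply, ← nsmul_eq_mul, AddChar.map_nsmul_eq_pow]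

lemma isIntegral_quadraticGaussSum : IsIntegral ℤ (quadraticGaussSum p) := by
  refine IsIntegral.sum _ fun a _ => IsIntegral.mul ?_ ?_
  · exact isIntegral_algebraMap (R := ℤ) (A := ℂ) (x := quadraticChar (ZMod p) a)
  · refine IsIntegral.of_pow (n := p) (Fact.out : p.Prime).pos ?_
    rw [← AddChar.map_nsmul_eq_pow]
    simp [isIntegral_one]

end QuadraticChar

/-- A complex algebraic integer with a nonzero integer multiple in `ℤ` is a rational integer. -/
lemma exists_intCast_eq_of_isIntegral {x : ℂ} (hx : IsIntegral ℤ x) {c z : ℤ} (hc : c ≠ 0)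
    (h : (c : ℂ) * x = z) : ∃ a : ℤ, x = a := by
  have hc' : (c : ℂ) ≠ 0 := Int.cast_ne_zero.2 hc
  have hq : x = algebraMap ℚ ℂ ((z : ℚ) / c) := by
    simp only [map_div₀, map_intCast]
    field_simp
    linear_combination h
  rw [hq, isIntegral_algebraMap_iff (algebraMap ℚ ℂ).injective,
    IsIntegrallyClosed.isIntegral_iff] at hx
  obtain ⟨a, ha⟩ := hx
  exact ⟨a, by rw [hq, ← ha]; simp⟩

/-- If `w` is an algebraic integer of the form `2α + 1`, `g² = -p` and `w g` is rational,
then `w² = -p a²` for a nonzero integer `a`. -/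
lemma exists_sq_eq_neg_mul_sq {p : ℕ} (hp : p.Prime) {α g : ℂ} (hα : IsIntegral ℤ α)
    (hg : IsIntegral ℤ g) (hgsq : g ^ 2 = -p) {c z : ℤ} (hc : c ≠ 0)
    (h : (c : ℂ) * ((2 * α + 1) * g) = z) :
    ∃ a : ℤ, a ≠ 0 ∧ (2 * α + 1) ^ 2 = -(p : ℂ) * a ^ 2 := by
  have hp0 : (p : ℂ) ≠ 0 := Nat.cast_ne_zero.2 hp.ne_zero
  have h2 : IsIntegral ℤ (2 * α + 1) := by
    have := (hα.add hα).add isIntegral_one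
    rwa [← two_mul] at this
  obtain ⟨k, hk⟩ := exists_intCast_eq_of_isIntegral (h2.mul hg) hc h
  have hksq : (k : ℂ) ^ 2 = -p * (2 * α + 1) ^ 2 := by
    rw [← hk, mul_pow, hgsq]; ring
  obtain ⟨b, hb⟩ := exists_intCast_eq_of_isIntegral (x := α * (α + 1)) (c := 4 * p)
    (z := -k ^ 2 - p) (hα.mul (hα.add isIntegral_one)) (by simpa using hp.ne_zero)
    (by push_cast; rw [hksq]; ring)
  have hkb : k ^ 2 = -p * (4 * b + 1) := by
    have : (k : ℂ) ^ 2 = -p * (4 * b + 1) := by rw [hksq, ← hb]; ring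
    exact_mod_cast this
  obtain ⟨a, rfl⟩ := (Nat.prime_iff_prime_int.1 hp).dvd_of_dvd_pow
    (show (p : ℤ) ∣ k ^ 2 from ⟨-(4 * b + 1), by rw [hkb]; ring⟩)
  refine ⟨a, ?_, ?_⟩
  · rintro rfl
    have : (4 * b + 1 : ℤ) = 0 := by
      simpa [hp.ne_zero] using hkb
    omega
  · have : (p : ℂ) * (2 * α + 1) ^ 2 = p * (-(p : ℂ) * a ^ 2) := by
      push_cast at hksq
      linear_combination hksq
    exact mul_left_cancel₀ hp0 this

section SkewSet

variable {G : Type*} [AddCommGroup G] [DecidableEq G] {D : Finset G}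

lemma zero_notMem_of_inter_neg_eq_empty (h : D ∩ D.image (fun d => -d) = ∅) : (0 : G) ∉ D := by
  intro h0
  have : (0 : G) ∈ D ∩ D.image (fun d => -d) :=
    mem_inter.2 ⟨h0, mem_image.2 ⟨0, h0, neg_zero⟩⟩
  simp [h] at this

lemma sum_comp_nsmul_of_image_eq {t : ℕ} (h : D.image (fun d => t • d) = D) (f : G → ℂ) :
    ∑ d ∈ D, f (t • d) = ∑ d ∈ D, f d := by
  conv_rhs => rw [← h]
  rw [sum_image (card_image_iff.1 (by rw [h]))]

variable [Fintype G]

/-- The number of representations of `g` as a difference of elements of `D`, by characters. -/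
lemma sum_addChar_eq_card_mul_card_filter (D : Finset G) (g : G) :
    ∑ ψ : AddChar G ℂ, (∑ d ∈ D, ψ d) * (∑ d ∈ D, ψ (-d)) * ψ (-g) =
      Fintype.card G * ((univ ×ˢ univ).filter
        (fun q : G × G => q.1 ∈ D ∧ q.2 ∈ D ∧ q.1 - q.2 = g)).card := by
  have hf : (univ ×ˢ univ).filter (fun q : G × G => q.1 ∈ D ∧ q.2 ∈ D ∧ q.1 - q.2 = g) =
      (D ×ˢ D).filter (fun q => q.1 + -q.2 + -g = 0) := by
    ext q
    simp [← sub_eq_add_neg, sub_eq_zero, and_assoc]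
  rw [hf, card_filter]
  push_cast
  simp_rw [sum_mul_sum, ← sum_product', sum_mul]
  rw [sum_comm, mul_sum]
  refine sum_congr rfl fun q _ => ?_
  simp_rw [← AddChar.map_add_eq_mul]
  rw [AddChar.sum_apply_eq_ite]
  simp

lemma card_filter_sub_eq_zero (D : Finset G) :
    ((univ ×ˢ univ).filter
      (fun q : G × G => q.1 ∈ D ∧ q.2 ∈ D ∧ q.1 - q.2 = 0)).card = D.card := by
  have : (univ ×ˢ univ).filter (fun q : G × G => q.1 ∈ D ∧ q.2 ∈ D ∧ q.1 - q.2 = 0) =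
      D.image fun d => (d, d) := by
    ext ⟨a, b⟩
    simp only [mem_filter, mem_product, mem_univ, mem_image, Prod.mk.injEq, sub_eq_zero]
    constructor
    · rintro ⟨-, ha, -, rfl⟩
      exact ⟨a, ha, rfl, rfl⟩
    · rintro ⟨d, hd, rfl, rfl⟩
      exact ⟨⟨trivial, trivial⟩, hd, hd, rfl⟩
  rw [this, card_image_of_injective _ fun a b h => (Prod.mk.inj h).1]

/-- A sum over the group splits along a skew set. -/
lemma sum_add_sum_neg_add_zero (h1 : D ∩ D.image (fun d => -d) = ∅)
    (h2 : D ∪ D.image (fun d => -d) ∪ {0} = univ) (f : G → ℂ) :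
    ∑ d ∈ D, f d + ∑ d ∈ D, f (-d) + f 0 = ∑ x, f x := by
  have h0 := zero_notMem_of_inter_neg_eq_empty h1
  rw [← h2, sum_union (by simp [h0]), sum_union (disjoint_iff_inter_eq_empty.2 h1),
    sum_image neg_injective.injOn, sum_singleton]

variable {p m : ℕ} [Fact p.Prime]

/-- The twist of `ψ(D) - ψ(-D)` by `t` is multiplication by the quadratic symbol of `t`. -/
lemma sum_pow_sub_pow_eq_complexQuadraticChar_mul (hp4 : p % 4 = 3) (hm : m ≠ 0)
    (hG : Fintype.card G = p ^ m)
    (hQR : ∀ t : ℕ, ¬ (p ∣ t) → (∃ s : ℕ, t ≡ s ^ 2 [MOD p]) → D.image (fun d => t • d) = D)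
    (ψ : AddChar G ℂ) {t : ℕ} (ht : ¬ p ∣ t) :
    ∑ d ∈ D, (ψ d ^ t - ψ (-d) ^ t) =
      complexQuadraticChar p t * ∑ d ∈ D, (ψ d - ψ (-d)) := by
  have residue {t : ℕ} (ht : ¬ p ∣ t) (h1 : quadraticChar (ZMod p) t = 1) :
      D.image (fun d => t • d) = D := by
    have ht0 : (t : ZMod p) ≠ 0 := by rwa [Ne, ZMod.natCast_eq_zero_iff]
    obtain ⟨s, hs⟩ := (quadraticChar_one_iff_isSquare ht0).1 h1
    refine hQR t ht ⟨s.val, ?_⟩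
    rw [← ZMod.natCast_eq_natCast_iff]
    simp [hs, pow_two]
  have ht0 : (t : ZMod p) ≠ 0 := by rwa [Ne, ZMod.natCast_eq_zero_iff]
  simp_rw [← AddChar.map_nsmul_eq_pow, smul_neg]
  rw [complexQuadraticChar_apply]
  rcases quadraticChar_dichotomy ht0 with h | h
  · rw [h, Int.cast_one, one_mul]
    exact sum_comp_nsmul_of_image_eq (residue ht h) fun x => ψ x - ψ (-x)
  · have hpos : 1 ≤ p ^ m := Nat.one_le_pow _ _ (Fact.out : p.Prime).pos
    have hcast : ((t * (p ^ m - 1) : ℕ) : ZMod p) = -t := by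
      push_cast [hpos]
      simp [hm]
    have hsmul (d : G) : (t * (p ^ m - 1)) • d = -(t • d) := by
      rw [eq_neg_iff_add_eq_zero, ← add_smul, ← Nat.mul_succ, Nat.succ_eq_add_one,
        Nat.sub_add_cancel hpos, mul_smul, ← hG, card_nsmul_eq_zero, smul_zero]
    have hdvd : ¬ p ∣ t * (p ^ m - 1) := by
      rw [← ZMod.natCast_eq_zero_iff, hcast, neg_eq_zero]
      exact ht0
    have key := sum_comp_nsmul_of_image_eq (residue hdvd (by
      rw [hcast, neg_eq_neg_one_mul, map_mul, h, quadraticChar_neg_one_of_mod_four hp4]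
      norm_num)) fun x => ψ x - ψ (-x)
    simp_rw [hsmul, neg_neg] at key
    rw [h, ← key, mul_sum]
    refine sum_congr rfl fun d _ => ?_
    push_cast
    ring

/-- `ψ(D) - ψ(-D)` times the quadratic Gauss sum is rational. -/
lemma exists_intCast_mul_sum_mul_quadraticGaussSum_eq (hp4 : p % 4 = 3) (hm : m ≠ 0)
    (hG : Fintype.card G = p ^ m)
    (hQR : ∀ t : ℕ, ¬ (p ∣ t) → (∃ s : ℕ, t ≡ s ^ 2 [MOD p]) → D.image (fun d => t • d) = D)
    (ψ : AddChar G ℂ) :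
    ∃ c z : ℤ, c ≠ 0 ∧ (c : ℂ) * ((∑ d ∈ D, (ψ d - ψ (-d))) * quadraticGaussSum p) = z := by
  have hp : p.Prime := Fact.out
  set u := ∑ d ∈ D, (ψ d - ψ (-d)) with hu
  have hterm (t : ℕ) : (∑ d ∈ D, (ψ d ^ t - ψ (-d) ^ t)) *
      (∑ a : ZMod p, complexQuadraticChar p a * (ZMod.stdAddChar a : ℂ) ^ t) =
      if p ∣ t then 0 else u * quadraticGaussSum p := by
    rw [sum_complexQuadraticChar_mul_pow hp4]
    split_ifs with ht
    · rw [(ZMod.natCast_eq_zero_iff t p).2 ht, MulChar.map_zero, zero_mul, mul_zero]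
    · rw [sum_pow_sub_pow_eq_complexQuadraticChar_mul hp4 hm hG hQR ψ ht, ← hu]
      have ht0 : (t : ZMod p) ≠ 0 := by rwa [Ne, ZMod.natCast_eq_zero_iff]
      have hsq : complexQuadraticChar p t ^ 2 = 1 := by
        rw [complexQuadraticChar_apply]
        exact_mod_cast quadraticChar_sq_one ht0
      linear_combination u * quadraticGaussSum p * hsq
  have hmem : ∑ t ∈ range (p ^ m), (∑ d ∈ D, (ψ d ^ t - ψ (-d) ^ t)) *
      (∑ a : ZMod p, complexQuadraticChar p a * (ZMod.stdAddChar a : ℂ) ^ t) ∈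
      (Int.castRingHom ℂ).range := by
    have hroot (x : G) (a : ZMod p) : (ψ x * (ZMod.stdAddChar a : ℂ)) ^ (p ^ m) = 1 := by
      rw [mul_pow, ← AddChar.map_nsmul_eq_pow, ← AddChar.map_nsmul_eq_pow, ← hG,
        card_nsmul_eq_zero, hG, nsmul_eq_mul]
      simp [hm]
    simp_rw [sum_mul_sum]
    rw [sum_comm]
    refine sum_mem fun d _ => ?_
    rw [sum_comm]
    refine sum_mem fun a _ => ?_
    have : ∑ t ∈ range (p ^ m), (ψ d ^ t - ψ (-d) ^ t) *
        (complexQuadraticChar p a * (ZMod.stdAddChar a : ℂ) ^ t) =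
        complexQuadraticChar p a *
          (∑ t ∈ range (p ^ m), (ψ d * (ZMod.stdAddChar a : ℂ)) ^ t -
            ∑ t ∈ range (p ^ m), (ψ (-d) * (ZMod.stdAddChar a : ℂ)) ^ t) := by
      rw [← sum_sub_distrib, mul_sum]
      refine sum_congr rfl fun t _ => ?_
      ring
    rw [this]
    exact mul_mem ⟨_, rfl⟩ (sub_mem (geom_sum_mem_range_intCast (hroot _ _))
      (geom_sum_mem_range_intCast (hroot _ _)))
  obtain ⟨z, hz⟩ := hmem
  simp_rw [hterm] at hz
  rw [sum_ite, sum_const_zero, zero_add, sum_const, nsmul_eq_mul] at hz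
  refine ⟨((range (p ^ m)).filter (fun t => ¬ p ∣ t)).card, z, ?_, ?_⟩
  · rw [Nat.cast_ne_zero, ← Nat.pos_iff_ne_zero, card_pos]
    exact ⟨1, mem_filter.2 ⟨mem_range.2 (Nat.one_lt_pow hm hp.one_lt), hp.not_dvd_one⟩⟩
  · rw [Int.cast_natCast, ← hz]
    rfl

end SkewSet


/-- A sufficient character-theoretic condition for a skew subset of an abelian group of
order `p^m` (`p ≡ 3 (mod 4)` prime, `m` odd), invariant under multiplication by nonzero
quadratic residues mod `p`, to be a `(p^m, (p^m-1)/2, (p^m-3)/4)` difference set. -/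
theorem skew_subset_difference_set_of_char_condition
    (p m : ℕ) (hp : p.Prime) (hp4 : p % 4 = 3) (hm : Odd m)
    (G : Type*) [AddCommGroup G] [Fintype G] [DecidableEq G]
    (hG : Fintype.card G = p ^ m) (D : Finset G)
    (hskew1 : D ∩ D.image (fun d => -d) = ∅)
    (hskew2 : D ∪ D.image (fun d => -d) ∪ {0} = Finset.univ)
    (hQR : ∀ t : ℕ, ¬ (p ∣ t) → (∃ s : ℕ, t ≡ s ^ 2 [MOD p]) →
      D.image (fun d => t • d) = D)
    (hchar : ∀ ψ : AddChar G ℂ, ψ ≠ 1 →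
      IsIntegral ℤ (((∑ d ∈ D, ψ d) - ((p : ℂ) ^ ((m - 1) / 2) - 1) / 2) /
        (p : ℂ) ^ ((m - 1) / 2))) :
    ∀ g : G, g ≠ 0 →
      ((Finset.univ ×ˢ Finset.univ).filter
        (fun q : G × G => q.1 ∈ D ∧ q.2 ∈ D ∧ q.1 - q.2 = g)).card =
      (p ^ m - 3) / 4 := by
  have : Fact p.Prime := ⟨hp⟩
  classical
  obtain ⟨n, rfl⟩ := hm
  have hn : (2 * n + 1 - 1) / 2 = n := by omega
  rw [hn] at hchar
  have hp0 : (p : ℂ) ≠ 0 := Nat.cast_ne_zero.2 hp.ne_zero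
  have hpn : (p : ℂ) ^ n ≠ 0 := pow_ne_zero _ hp0
  set N := p ^ (2 * n + 1) with hN
  have hNpos : 0 < N := pow_pos hp.pos _
  have hN0 : (N : ℂ) ≠ 0 := Nat.cast_ne_zero.2 hNpos.ne'
  have hcard : (2 * D.card + 1 : ℂ) = N := by
    have := sum_add_sum_neg_add_zero hskew1 hskew2 fun _ => 1
    simp only [sum_const, card_univ, hG, nsmul_eq_mul, mul_one] at this
    linear_combination this
  have hsum (ψ : AddChar G ℂ) (hψ : ψ ≠ 1) :
      ∑ d ∈ D, ψ d + ∑ d ∈ D, ψ (-d) = -1 := by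
    have := sum_add_sum_neg_add_zero hskew1 hskew2 ψ
    rw [AddChar.sum_eq_ite, if_neg (show ψ ≠ 0 from hψ), AddChar.map_zero_eq_one] at this
    linear_combination this
  have hsq (ψ : AddChar G ℂ) : ∃ a : ℤ, ψ ≠ 1 → a ≠ 0 ∧
      4 * ((∑ d ∈ D, ψ d) * ∑ d ∈ D, ψ (-d)) = 1 + N * a ^ 2 := by
    by_cases hψ : ψ = 1
    · exact ⟨0, fun h => absurd hψ h⟩
    obtain ⟨c, z, hc, hz⟩ :=
      exists_intCast_mul_sum_mul_quadraticGaussSum_eq hp4 (by omega) hG hQR ψ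
    rw [sum_sub_distrib] at hz
    have hs := hsum ψ hψ
    have hα := hchar ψ hψ
    set S := ∑ d ∈ D, ψ d
    set S' := ∑ d ∈ D, ψ (-d)
    set α := (S - ((p : ℂ) ^ n - 1) / 2) / (p : ℂ) ^ n with hαdef
    have hw : (2 * α + 1) * (p : ℂ) ^ n = S - S' := by
      rw [hαdef]
      field_simp
      linear_combination hs
    obtain ⟨a, ha, hwa⟩ := exists_sq_eq_neg_mul_sq hp hα isIntegral_quadraticGaussSum
      (quadraticGaussSum_sq hp4) (c := c * p ^ n) (z := z)
      (mul_ne_zero hc (pow_ne_zero _ (by exact_mod_cast hp.ne_zero)))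
      (by rw [← hz, ← hw]; push_cast; ring)
    refine ⟨a, fun _ => ⟨ha, ?_⟩⟩
    have hu : (S - S') ^ 2 = -N * a ^ 2 := by
      rw [← hw, mul_pow, hwa, hN]
      push_cast
      ring
    linear_combination -hu + (S + S' - 1) * hs
  choose a ha using hsq
  have hone (h : G) : (∑ d ∈ D, (1 : AddChar G ℂ) d) * (∑ d ∈ D, (1 : AddChar G ℂ) (-d)) *
      (1 : AddChar G ℂ) h = (D.card : ℂ) ^ 2 := by
    simp [pow_two]
  have hcardψ : (univ.erase (1 : AddChar G ℂ)).card = N - 1 := by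
    rw [card_erase_of_mem (mem_univ _), card_univ, AddChar.card_eq, hG]
  have hcardψ' : ((univ.erase (1 : AddChar G ℂ)).card : ℂ) = N - 1 := by
    rw [hcardψ, Nat.cast_sub hNpos, Nat.cast_one]
  have hparseval : ∑ ψ ∈ univ.erase (1 : AddChar G ℂ), a ψ ^ 2 =
      ∑ ψ ∈ univ.erase (1 : AddChar G ℂ), 1 := by
    have h := sum_addChar_eq_card_mul_card_filter D 0
    rw [card_filter_sub_eq_zero, hG, ← add_sum_erase _ _ (mem_univ 1), hone] at h
    have h' : 4 * ∑ ψ ∈ univ.erase (1 : AddChar G ℂ),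
        (∑ d ∈ D, ψ d) * (∑ d ∈ D, ψ (-d)) * ψ (-0) =
        (N - 1) + N * ∑ ψ ∈ univ.erase (1 : AddChar G ℂ), (a ψ : ℂ) ^ 2 := by
      rw [← hcardψ', card_eq_sum_ones, mul_sum, mul_sum]
      push_cast
      rw [← sum_add_distrib]
      refine sum_congr rfl fun ψ hψ => ?_
      rw [neg_zero, AddChar.map_zero_eq_one, mul_one, (ha ψ (ne_of_mem_erase hψ)).2]
    have h3 : ∑ ψ ∈ univ.erase (1 : AddChar G ℂ), (a ψ : ℂ) ^ 2 = N - 1 := by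
      refine mul_left_cancel₀ hN0 ?_
      linear_combination -h' + 4 * h - (2 * D.card - N - 1) * hcard
    rw [← hcardψ', card_eq_sum_ones] at h3
    exact_mod_cast h3
  have hle (ψ : AddChar G ℂ) (hψ : ψ ∈ univ.erase (1 : AddChar G ℂ)) : 1 ≤ a ψ ^ 2 := by
    have := pow_pos (abs_pos.2 (ha ψ (ne_of_mem_erase hψ)).1) 2
    rw [sq_abs] at this
    omega
  have hall := (sum_eq_sum_iff_of_le hle).1 hparseval.symm
  intro g hg
  have h := sum_addChar_eq_card_mul_card_filter D g
  rw [hG, ← add_sum_erase _ _ (mem_univ 1), hone] at h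
  set k := ((univ ×ˢ univ).filter
    (fun q : G × G => q.1 ∈ D ∧ q.2 ∈ D ∧ q.1 - q.2 = g)).card
  have hchars : ∑ ψ ∈ univ.erase (1 : AddChar G ℂ), ψ (-g) = -1 := by
    have := AddChar.sum_apply_eq_ite (-g)
    rw [if_neg (neg_ne_zero.2 hg), ← add_sum_erase _ _ (mem_univ 1), AddChar.one_apply] at this
    linear_combination this
  have h' : 4 * ∑ ψ ∈ univ.erase (1 : AddChar G ℂ),
      (∑ d ∈ D, ψ d) * (∑ d ∈ D, ψ (-d)) * ψ (-g) = -(1 + N) := by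
    rw [← mul_neg_one, ← hchars, mul_sum, mul_sum]
    refine sum_congr rfl fun ψ hψ => ?_
    have h1 : (a ψ : ℂ) ^ 2 = 1 := by exact_mod_cast (hall ψ hψ).symm
    rw [← mul_assoc, (ha ψ (ne_of_mem_erase hψ)).2, h1, mul_one]
  have hk : (4 * k + 3 : ℂ) = N := by
    refine mul_left_cancel₀ hN0 ?_
    linear_combination h' - 4 * h + (2 * D.card + N - 1) * hcard
  have hk' : 4 * k + 3 = N := by exact_mod_cast hk
  omega
end

section
/- Let q = 3^m with m odd and m not divisible by 3, and let b be a nonzero element of GF(q). If b is a square in GF(q)^*, then D_{b^2} = b^7·D_1; if b is a nonsquare in GF(q)^*, then D_{b^2} = −b^7·D_1 (where c·S = {c·s : s ∈ S}). -/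
/-- In a finite field of cardinality `3 ^ m` with `m` odd, `-1` is not a square. -/
theorem not_isSquare_neg_one_of_card_eq_three_pow {m : ℕ} (hm : Odd m) {F : Type*} [Field F]
    [Fintype F] (hcard : Fintype.card F = 3 ^ m) : ¬ IsSquare (-1 : F) := by
  rw [FiniteField.isSquare_neg_one_iff, hcard, not_not]
  obtain ⟨k, rfl⟩ := hm
  rw [pow_succ, pow_mul, Nat.mul_mod, Nat.pow_mod]
  norm_num

/-- In a finite field where `-1` is not a square, the negative of a nonsquare is a square. -/
theorem isSquare_neg_of_not_isSquare {F : Type*} [Field F] [Finite F]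
    (h : ¬ IsSquare (-1 : F)) {b : F} (hb : ¬ IsSquare b) : IsSquare (-b) := by
  classical
  have := Fintype.ofFinite F
  have hb0 : b ≠ 0 := by
    rintro rfl
    exact hb (IsSquare.zero)
  rw [← quadraticChar_one_iff_isSquare (neg_ne_zero.mpr hb0), neg_eq_neg_one_mul, map_mul,
    quadraticChar_neg_one_iff_not_isSquare.mpr h, quadraticChar_neg_one_iff_not_isSquare.mpr hb]
  norm_num

/-- Homogeneity of the Dickson polynomial of order 7: the values at nonzero squares with
parameter `c ^ 2`, where `c` is a nonzero square, are `c ^ 7` times those with parameter `1`. -/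
theorem dickson7_image_sq_of_isSquare {F : Type*} [Field F] {c : F} (hc0 : c ≠ 0)
    (hc : IsSquare c) :
    {y : F | ∃ x : F, x ≠ 0 ∧ y = (x ^ 2) ^ 7 - c ^ 2 * (x ^ 2) ^ 5
      - (c ^ 2) ^ 2 * (x ^ 2) ^ 3 - (c ^ 2) ^ 3 * x ^ 2} =
    (fun s => c ^ 7 * s) '' {y : F | ∃ x : F, x ≠ 0 ∧ y = (x ^ 2) ^ 7 - 1 * (x ^ 2) ^ 5
      - 1 ^ 2 * (x ^ 2) ^ 3 - 1 ^ 3 * x ^ 2} := by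
  obtain ⟨d, rfl⟩ := hc
  have hd : d ≠ 0 := left_ne_zero_of_mul hc0
  ext y
  constructor
  · rintro ⟨x, hx, rfl⟩
    refine ⟨_, ⟨x / d, div_ne_zero hx hd, rfl⟩, ?_⟩
    obtain ⟨z, rfl⟩ : ∃ z, x = d * z := ⟨x / d, (mul_div_cancel₀ x hd).symm⟩
    simp only [mul_div_cancel_left₀ z hd]
    ring
  · rintro ⟨_, ⟨x, hx, rfl⟩, rfl⟩
    exact ⟨d * x, mul_ne_zero hd hx, by ring⟩


/-- For `b ≠ 0` in `GF(3^m)` (`m` odd, `3 ∤ m`): if `b` is a square then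
`D_{b²} = b⁷·D_1`, and if `b` is a nonsquare then `D_{b²} = -b⁷·D_1`. -/
theorem dickson7_image_scaling
    (m : ℕ) (hm : Odd m) (hm3 : ¬ (3 ∣ m)) (F : Type*) [Field F] [Fintype F]
    (hcard : Fintype.card F = 3 ^ m) (b : F) (hb : b ≠ 0) :
    let Dset : F → Set F := fun v => {y | ∃ x : F, x ≠ 0 ∧
      y = (x ^ 2) ^ 7 - v * (x ^ 2) ^ 5 - v ^ 2 * (x ^ 2) ^ 3 - v ^ 3 * x ^ 2}
    (IsSquare b → Dset (b ^ 2) = (fun s => b ^ 7 * s) '' Dset 1) ∧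
    (¬ IsSquare b → Dset (b ^ 2) = (fun s => -b ^ 7 * s) '' Dset 1) := by
  intro Dset
  refine ⟨dickson7_image_sq_of_isSquare hb, fun h => ?_⟩
  have hneg := isSquare_neg_of_not_isSquare (not_isSquare_neg_one_of_card_eq_three_pow hm hcard) h
  have := dickson7_image_sq_of_isSquare (neg_ne_zero.mpr hb) hneg
  rwa [neg_sq, Odd.neg_pow (by decide : Odd 7)] at this
end

section
/- Let p be a prime, m ≥ 1, and let a^{(1)}, …, a^{(n)} be integers with p-ary representations a^{(j)} = Σ_{i=0}^{m−1} a_i^{(j)} p^i (digits in {0,…,p−1}), and let l_1, …, l_n be nonzero integers. Let s, 0 ≤ s ≤ p^m − 1, satisfy s ≡ l_1 a^{(1)} + ⋯ + l_n a^{(n)} (mod p^m − 1), with p-ary digits s_i. Then there exists a unique integer sequence c_{−1}, c_0, …, c_{m−1} with c_{−1} = c_{m−1} such that p·c_i + s_i = c_{i−1} + Σ_{j=1}^n l_j a_i^{(j)} for all 0 ≤ i ≤ m−1. Moreover, putting l_+ = Σ_{l_j>0} l_j and l_− = Σ_{l_j<0} l_j, every c_i satisfies l_− − 1 ≤ c_i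 ≤ l_+; and if a^{(j)} ≢ 0 (mod p^m − 1) for some j, then l_− ≤ c_i ≤ l_+ − 1 for all 0 ≤ i ≤ m−1. -/
/-- A predicate on `Fin m` that is stable under the cyclic predecessor and holds somewhere holds
everywhere. -/
lemma Fin.forall_of_sub_one {m : ℕ} [NeZero m] {P : Fin m → Prop} (hP : ∀ i, P i → P (i - 1))
    {i : Fin m} (hi : P i) (j : Fin m) : P j := by
  have key : ∀ k : ℕ, P (i - Fin.ofNat m k) := by
    intro k
    induction k with
    | zero => simpa using hi
    | succ k ih =>
      have h : i - Fin.ofNat m (k + 1) = i - Fin.ofNat m k - 1 := by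
        rw [sub_sub]
        congr 1
        ext
        simp [Fin.val_add]
      rw [h]
      exact hP _ ih
  have h := key (i - j).val
  simpa using h

/-- A cyclic solution of `p * c i = c (i - 1) + u i` is bounded by `L` as soon as every `u i` is
bounded by `(p - 1) * L`. -/
lemma cyclic_recurrence_le {m : ℕ} [NeZero m] {p L : ℤ} (hp : 1 < p) {c u : Fin m → ℤ}
    (hc : ∀ i, p * c i = c (i - 1) + u i) (hu : ∀ i, u i ≤ (p - 1) * L) (i : Fin m) :
    c i ≤ L := by
  obtain ⟨k, hk⟩ := Finite.exists_max c
  refine (hk i).trans ?_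
  have h₁ := hc k
  have h₂ := hk (k - 1)
  have h₃ := hu k
  nlinarith

/-- The bound of `cyclic_recurrence_le` is strict everywhere if it is strict for one `u i`. -/
lemma cyclic_recurrence_lt {m : ℕ} [NeZero m] {p L : ℤ} (hp : 1 < p) {c u : Fin m → ℤ}
    (hc : ∀ i, p * c i = c (i - 1) + u i) (hu : ∀ i, u i ≤ (p - 1) * L)
    (hlt : ∃ i, u i < (p - 1) * L) (i : Fin m) : c i < L := by
  have hle := cyclic_recurrence_le hp hc hu
  refine lt_of_le_of_ne (hle i) fun hi => ?_
  have hall : ∀ j, c j = L := Fin.forall_of_sub_one (fun j hj => by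
    have h₁ := hc j
    have h₂ := hle (j - 1)
    have h₃ := hu j
    rw [hj] at h₁
    linarith) hi
  obtain ⟨k, hk⟩ := hlt
  have h := hc k
  rw [hall, hall] at h
  linarith

/-- A cyclic solution of `p * c i = c (i - 1) + u i` is unique. -/
lemma cyclic_recurrence_unique {m : ℕ} [NeZero m] {p : ℤ} (hp : 1 < p) {c d u : Fin m → ℤ}
    (hc : ∀ i, p * c i = c (i - 1) + u i) (hd : ∀ i, p * d i = d (i - 1) + u i) : c = d := by
  have key : ∀ {c d : Fin m → ℤ}, (∀ i, p * c i = c (i - 1) + u i) →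
      (∀ i, p * d i = d (i - 1) + u i) → ∀ i, c i ≤ d i := by
    intro c d hc hd i
    have h := cyclic_recurrence_le (L := 0) (c := fun i => c i - d i) (u := fun _ => 0) hp
      (fun i => by linear_combination hc i - hd i) (by simp) i
    linarith
  exact funext fun i => le_antisymm (key hc hd i) (key hd hc i)

/-- A number with `m` equal base-`p` digits `d` is `d` times a repunit. -/
lemma sub_one_mul_eq_of_forall_digit_eq {p m a d : ℕ} (ha : a < p ^ m)
    (h : ∀ i < m, a / p ^ i % p = d) : ((p : ℤ) - 1) * a = d * ((p : ℤ) ^ m - 1) := by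
  have key : ∀ k ≤ m, ((p : ℤ) - 1) * (a % p ^ k : ℕ) = d * ((p : ℤ) ^ k - 1) := by
    intro k
    induction k with
    | zero => simp [Nat.mod_one]
    | succ k ih =>
      intro hk
      rw [Nat.mod_pow_succ, h k hk, pow_succ]
      push_cast at ih ⊢
      linear_combination ih (by lia)
  simpa [Nat.mod_eq_of_lt ha] using key m le_rfl

lemma mul_digit_le {p x : ℕ} (l : ℤ) (hx : x < p) :
    l * (x : ℤ) ≤ ((p : ℤ) - 1) * max l 0 := by
  have h : (x : ℤ) ≤ p - 1 := by lia
  rcases le_total l 0 with h₀ | h₀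
  · rw [max_eq_right h₀]
    nlinarith
  · rw [max_eq_left h₀]
    nlinarith

lemma sum_mul_digit_le {p m n : ℕ} (hp : 0 < p) (a : Fin n → ℕ) (l : Fin n → ℤ) (i : Fin m) :
    ∑ j, l j * ((a j / p ^ (i : ℕ) % p : ℕ) : ℤ) ≤ ((p : ℤ) - 1) * ∑ j, max (l j) 0 := by
  rw [Finset.mul_sum]
  exact Finset.sum_le_sum fun j _ => mul_digit_le _ (Nat.mod_lt _ hp)

lemma exists_sum_mul_digit_lt {p m n : ℕ} (hp : 1 < p) {a : Fin n → ℕ}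
    (ha : ∀ j, a j < p ^ m) {l : Fin n → ℤ} (hl : ∀ j, l j ≠ 0)
    (hdvd : ∃ j, ¬ ((p : ℤ) ^ m - 1 ∣ (a j : ℤ))) :
    ∃ i : Fin m,
      ∑ j, l j * ((a j / p ^ (i : ℕ) % p : ℕ) : ℤ) < ((p : ℤ) - 1) * ∑ j, max (l j) 0 := by
  by_contra! hge
  obtain ⟨j, hj⟩ := hdvd
  have hp₁ : (p : ℤ) - 1 ≠ 0 := by lia
  have heq : ∀ i < m, l j * ((a j / p ^ i % p : ℕ) : ℤ) = ((p : ℤ) - 1) * max (l j) 0 := by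
    intro i hi
    have hsum := le_antisymm (sum_mul_digit_le (by lia) a l ⟨i, hi⟩) (hge ⟨i, hi⟩)
    rw [Finset.mul_sum, Finset.sum_eq_sum_iff_of_le
      fun j _ => mul_digit_le _ (Nat.mod_lt _ (by lia))] at hsum
    exact hsum j (Finset.mem_univ j)
  apply hj
  rcases lt_or_gt_of_ne (hl j) with h | h
  · have hdig : ∀ i < m, a j / p ^ i % p = 0 := fun i hi => by
      have := heq i hi
      rw [max_eq_right h.le, mul_zero] at this
      exact_mod_cast (mul_eq_zero.mp this).resolve_left (hl j)
    have := sub_one_mul_eq_of_forall_digit_eq (ha j) hdig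
    rw [Nat.cast_zero, zero_mul] at this
    rw [(mul_eq_zero.mp this).resolve_left hp₁]
    exact dvd_zero _
  · have hdig : ∀ i < m, a j / p ^ i % p = p - 1 := fun i hi => by
      have := heq i hi
      rw [max_eq_left h.le, mul_comm] at this
      have := mul_right_cancel₀ (hl j) this
      lia
    have := sub_one_mul_eq_of_forall_digit_eq (ha j) hdig
    rw [Nat.cast_pred (by lia)] at this
    rw [mul_left_cancel₀ hp₁ this]

lemma exists_carry_sequence {p m n : ℕ} [NeZero m] (a : Fin n → ℕ) (ha : ∀ j, a j < p ^ m)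
    (l : Fin n → ℤ) (s : ℕ) (hs : s < p ^ m)
    (hcong : Int.ModEq ((p : ℤ) ^ m - 1) (s : ℤ) (∑ j, l j * (a j : ℤ))) :
    ∃ c : Fin m → ℤ, ∀ i : Fin m,
      (p : ℤ) * c i + ((s / p ^ (i : ℕ) % p : ℕ) : ℤ) =
        c (i - 1) + ∑ j, l j * ((a j / p ^ (i : ℕ) % p : ℕ) : ℤ) := by
  obtain ⟨C, hC⟩ := hcong.dvd
  let e : ℕ → ℤ := fun k =>
    (p : ℤ) ^ (m - k) * C + (s / p ^ k : ℕ) - ∑ j, l j * ((a j / p ^ k : ℕ) : ℤ)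
  have hdigit : ∀ x k : ℕ,
      ((x / p ^ k % p : ℕ) : ℤ) = (x / p ^ k : ℕ) - p * (x / p ^ (k + 1) : ℕ) := by
    intro x k
    have := Nat.mod_add_div (x / p ^ k) p
    rw [Nat.div_div_eq_div_mul, ← pow_succ] at this
    zify at this ⊢
    linarith
  have hstep : ∀ k < m, (p : ℤ) * e (k + 1) + ((s / p ^ k % p : ℕ) : ℤ) =
      e k + ∑ j, l j * ((a j / p ^ k % p : ℕ) : ℤ) := by
    intro k hk
    have hpow : (p : ℤ) ^ (m - k) = p * p ^ (m - (k + 1)) := by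
      rw [← pow_succ']
      congr 1
      lia
    simp only [e, hdigit, mul_sub, Finset.sum_sub_distrib, Finset.mul_sum, hpow,
      mul_left_comm (p : ℤ)]
    ring
  have hwrap : e 0 = e m := by
    simp only [e, Nat.div_eq_of_lt hs, fun j => Nat.div_eq_of_lt (ha j)]
    simp
    linarith
  refine ⟨fun i => e (i + 1), fun i => ?_⟩
  rw [hstep i i.isLt]
  congr 1
  rcases eq_or_ne i 0 with rfl | hi
  · have : ((0 - 1 : Fin m) : ℕ) + 1 = m := by
      have := NeZero.pos m
      obtain ⟨k, rfl⟩ : ∃ k, m = k + 1 := ⟨m - 1, by lia⟩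
      simp
    simpa only [this, Fin.val_zero] using hwrap
  · have : ((i - 1 : Fin m) : ℕ) + 1 = i := by
      have := Fin.val_sub_one_of_ne_zero hi
      have : (i : ℕ) ≠ 0 := fun h => hi (Fin.ext h)
      lia
    simp only [this]


/-- **Carry theorem (Helleseth et al.).** Let `p` be a prime and `s ≡ Σ_j l_j a^{(j)}
(mod p^m − 1)` with `0 ≤ s, a^{(j)} < p^m`. Then there is a unique sequence of carries
`c : Fin m → ℤ` (with `c_{-1} = c_{m-1}`, encoded by cyclic index subtraction) such that
`p·c_i + s_i = c_{i-1} + Σ_j l_j a_i^{(j)}` for all `i`; moreover every carry satisfies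
`l_- − 1 ≤ c_i ≤ l_+`, and `l_- ≤ c_i ≤ l_+ − 1` if some `a^{(j)} ≢ 0 (mod p^m − 1)`. -/
theorem carry_sequence_exists_unique_and_bounds
    (p : ℕ) (hp : p.Prime) (m : ℕ) [NeZero m] (n : ℕ)
    (a : Fin n → ℕ) (ha : ∀ j, a j < p ^ m)
    (l : Fin n → ℤ) (hl : ∀ j, l j ≠ 0)
    (s : ℕ) (hs : s < p ^ m)
    (hcong : Int.ModEq ((p : ℤ) ^ m - 1) (s : ℤ) (∑ j, l j * (a j : ℤ))) :
    (∃! c : Fin m → ℤ, ∀ i : Fin m,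
      (p : ℤ) * c i + ((s / p ^ (i : ℕ) % p : ℕ) : ℤ) =
        c (i - 1) + ∑ j, l j * ((a j / p ^ (i : ℕ) % p : ℕ) : ℤ)) ∧
    (∀ c : Fin m → ℤ,
      (∀ i : Fin m,
        (p : ℤ) * c i + ((s / p ^ (i : ℕ) % p : ℕ) : ℤ) =
          c (i - 1) + ∑ j, l j * ((a j / p ^ (i : ℕ) % p : ℕ) : ℤ)) →
      (∀ i : Fin m,
        (∑ j ∈ Finset.univ.filter (fun j => l j < 0), l j) - 1 ≤ c i ∧
          c i ≤ ∑ j ∈ Finset.univ.filter (fun j => 0 < l j), l j) ∧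
      ((∃ j, ¬ ((p : ℤ) ^ m - 1 ∣ (a j : ℤ))) →
        ∀ i : Fin m,
          (∑ j ∈ Finset.univ.filter (fun j => l j < 0), l j) ≤ c i ∧
            c i ≤ (∑ j ∈ Finset.univ.filter (fun j => 0 < l j), l j) - 1)) := by
  have hp₁ : (1 : ℤ) < p := by exact_mod_cast hp.one_lt
  have hplus : ∑ j ∈ Finset.univ.filter (fun j => 0 < l j), l j = ∑ j, max (l j) 0 := by
    rw [Finset.sum_filter]
    exact Finset.sum_congr rfl fun j _ => by grind
  have hminus : ∑ j ∈ Finset.univ.filter (fun j => l j < 0), l j = -∑ j, max (-l j) 0 := by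
    rw [Finset.sum_filter, ← Finset.sum_neg_distrib]
    exact Finset.sum_congr rfl fun j _ => by grind
  have hneg : ∀ i : Fin m, ∑ j, -l j * ((a j / p ^ (i : ℕ) % p : ℕ) : ℤ) =
      -∑ j, l j * ((a j / p ^ (i : ℕ) % p : ℕ) : ℤ) := fun i => by
    simp only [neg_mul, Finset.sum_neg_distrib]
  have hs₀ : ∀ i : Fin m, (0 : ℤ) ≤ (s / p ^ (i : ℕ) % p : ℕ) := fun i => Int.natCast_nonneg _
  have hs₁ : ∀ i : Fin m, ((s / p ^ (i : ℕ) % p : ℕ) : ℤ) ≤ p - 1 := fun i => by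
    have := Nat.mod_lt (s / p ^ (i : ℕ)) hp.pos
    lia
  have hupper := sum_mul_digit_le (m := m) hp.pos a l
  have hlower := sum_mul_digit_le (m := m) hp.pos a (fun j => -l j)
  simp only [hneg] at hlower
  rw [hplus, hminus]
  refine ⟨?_, fun c hc => ?_⟩
  · obtain ⟨c, hc⟩ := exists_carry_sequence a ha l s hs hcong
    refine ⟨c, hc, fun d hd => ?_⟩
    exact cyclic_recurrence_unique hp₁
      (u := fun i => ∑ j, l j * ((a j / p ^ (i : ℕ) % p : ℕ) : ℤ) - (s / p ^ (i : ℕ) % p : ℕ))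
      (fun i => by linarith [hd i]) (fun i => by linarith [hc i])
  · have hrec : ∀ i, (p : ℤ) * c i = c (i - 1) +
        (∑ j, l j * ((a j / p ^ (i : ℕ) % p : ℕ) : ℤ) - (s / p ^ (i : ℕ) % p : ℕ)) :=
      fun i => by linarith [hc i]
    have hrec' : ∀ i, (p : ℤ) * -c i = -c (i - 1) +
        ((s / p ^ (i : ℕ) % p : ℕ) - ∑ j, l j * ((a j / p ^ (i : ℕ) % p : ℕ) : ℤ)) :=
      fun i => by linarith [hc i]
    have hu : ∀ i : Fin m, ∑ j, l j * ((a j / p ^ (i : ℕ) % p : ℕ) : ℤ) -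
        (s / p ^ (i : ℕ) % p : ℕ) ≤ ((p : ℤ) - 1) * ∑ j, max (l j) 0 :=
      fun i => by linarith [hupper i, hs₀ i]
    have hu' : ∀ i : Fin m, (s / p ^ (i : ℕ) % p : ℕ) -
        ∑ j, l j * ((a j / p ^ (i : ℕ) % p : ℕ) : ℤ) ≤
          ((p : ℤ) - 1) * (∑ j, max (-l j) 0 + 1) :=
      fun i => by linarith [hlower i, hs₁ i]
    refine ⟨fun i => ⟨?_, cyclic_recurrence_le hp₁ hrec hu i⟩, fun hdvd i => ⟨?_, ?_⟩⟩
    · linarith [cyclic_recurrence_le (c := fun i => -c i) hp₁ hrec' hu' i]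
    · obtain ⟨k, hk⟩ := exists_sum_mul_digit_lt hp.one_lt ha (fun j => neg_ne_zero.mpr (hl j)) hdvd
      rw [hneg] at hk
      have := cyclic_recurrence_lt (c := fun i => -c i) hp₁ hrec' hu'
        ⟨k, by linarith [hs₁ k]⟩ i
      linarith
    · obtain ⟨k, hk⟩ := exists_sum_mul_digit_lt hp.one_lt ha hl hdvd
      have := cyclic_recurrence_lt hp₁ hrec hu ⟨k, by linarith [hs₀ k]⟩ i
      linarith
end

section
/- Under the two-carry-sequence setup, for every index i we have a_i + c_i + e_i ≤ 4. -/
/-- **Two-carry-sequence bound.** With `b_i = 5 + a_{i−1} − a_{i−2} − a_i`,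
`d_i = 4 + a_{i−2} − a_{i−1} − a_i`, carry sequences `c` (values in `{0,…,3}`) and `e`
(values in `{0,1,2}`) with `b_i − 3c_i + c_{i−1} ∈ {0,1,2}` and
`d_i − 3e_i + e_{i−1} ∈ {0,1,2}`, all periodic with odd period `m`, we have
`a_i + c_i + e_i ≤ 4` for every `i`. -/
theorem two_carry_sum_le_four
    (m : ℕ) (hm : 0 < m) (hmo : Odd m)
    (a c e : ℤ → ℤ)
    (ha : ∀ i, 0 ≤ a i ∧ a i ≤ 2) (hap : ∀ i, a (i + (m : ℤ)) = a i)
    (hc : ∀ i, 0 ≤ c i ∧ c i ≤ 3) (hcp : ∀ i, c (i + (m : ℤ)) = c i)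
    (he : ∀ i, 0 ≤ e i ∧ e i ≤ 2) (hep : ∀ i, e (i + (m : ℤ)) = e i)
    (hs : ∀ i, 0 ≤ (5 + a (i - 1) - a (i - 2) - a i) - 3 * c i + c (i - 1) ∧
      (5 + a (i - 1) - a (i - 2) - a i) - 3 * c i + c (i - 1) ≤ 2)
    (ht : ∀ i, 0 ≤ (4 + a (i - 2) - a (i - 1) - a i) - 3 * e i + e (i - 1) ∧
      (4 + a (i - 2) - a (i - 1) - a i) - 3 * e i + e (i - 1) ≤ 2) :
    ∀ i, a i + c i + e i ≤ 4 := by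
  have carry_le : ∀ i, c i + e i ≤ 4 := fun i => by
    have ha₀ := ha i
    have hc₁ := hc (i - 1)
    have he₁ := he (i - 1)
    have hs₀ := hs i
    have ht₀ := ht i
    omega
  intro i
  have carry_le_prev := carry_le (i - 1)
  have carry_le_prev' := carry_le (i - 3)
  have ha₀ := ha i
  have ha₁ := ha (i - 1)
  have ha₂ := ha (i - 2)
  have ha₃ := ha (i - 3)
  have ha₄ := ha (i - 4)
  have hc₂ := hc (i - 2)
  have he₂ := he (i - 2)
  have he₃ := he (i - 3)
  have hs₀ := hs i
  have ht₀ := ht i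
  have hs₁ := hs (i - 1)
  have ht₁ := ht (i - 1)
  have hs₂ := hs (i - 2)
  have ht₂ := ht (i - 2)
  rw [show i - 1 - 1 = i - 2 by ring, show i - 1 - 2 = i - 3 by ring] at hs₁ ht₁
  rw [show i - 2 - 1 = i - 3 by ring, show i - 2 - 2 = i - 4 by ring] at hs₂ ht₂
  by_contra! h
  have a_eq : a i = 2 := by omega
  have a_prev_eq : a (i - 1) = 0 := by omega
  obtain ⟨c_prev_eq, e_prev_eq⟩ | ⟨c_prev_eq, e_prev_eq⟩ :
      c (i - 1) = 3 ∧ e (i - 1) = 1 ∨ c (i - 1) = 2 ∧ e (i - 1) = 2 := by omega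
  · have : a (i - 2) = 0 := by omega
    omega
  · have : a (i - 2) = 2 := by omega
    have : a (i - 3) = 2 := by omega
    have : e (i - 2) = 2 := by omega
    omega
end

section
/- Under the carry-sequence setup, for every index i we have c_i ≤ 5. -/
/-- **Carry bound.** In the carry-sequence setup with
`d_i = 9 − 2a_{i−1} + a_i − b_{i−2} + b_{i−1} − b_i` and carries `c_i ∈ {0,…,6}`
with `s_i = d_i − 3c_i + c_{i−1} ∈ {0,1,2}`, every carry satisfies `c_i ≤ 5`. -/
theorem carry_le_five
    (m : ℕ) (hm : 0 < m)
    (a b c : ℤ → ℤ)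
    (ha : ∀ i, 0 ≤ a i ∧ a i ≤ 2) (hap : ∀ i, a (i + (m : ℤ)) = a i)
    (hb : ∀ i, 0 ≤ b i ∧ b i ≤ 2) (hbp : ∀ i, b (i + (m : ℤ)) = b i)
    (hc : ∀ i, 0 ≤ c i ∧ c i ≤ 6) (hcp : ∀ i, c (i + (m : ℤ)) = c i)
    (hs : ∀ i, 0 ≤ (9 - 2 * a (i - 1) + a i - b (i - 2) + b (i - 1) - b i) - 3 * c i + c (i - 1) ∧
      (9 - 2 * a (i - 1) + a i - b (i - 2) + b (i - 1) - b i) - 3 * c i + c (i - 1) ≤ 2) :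
    ∀ i, c i ≤ 5 := by
  intro i
  have h₁ := hs i
  have h₂ := hs (i - 1)
  rw [show i - 1 - 1 = i - 2 by ring] at h₂
  have := ha (i - 2)
  have := ha (i - 1)
  have := ha i
  have := hb (i - 1 - 2)
  have := hb (i - 2)
  have := hb (i - 1)
  have := hb i
  have := hc (i - 2)
  have := hc (i - 1)
  have := hc i
  omega
end

section
/- Under the carry-sequence setup, if c_i = 5 for some index i, then c_{i−1} ≤ 4 and c_{i+1} ≤ 4. -/
/-- Two consecutive carries that are at least `5` cannot include a `5`. -/
theorem not_consecutive_carries_ge_five (a b c : ℤ → ℤ)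
    (ha : ∀ i, 0 ≤ a i ∧ a i ≤ 2) (hb : ∀ i, 0 ≤ b i ∧ b i ≤ 2)
    (hc : ∀ i, 0 ≤ c i ∧ c i ≤ 6)
    (hs : ∀ i, 0 ≤ (9 - 2 * a (i - 1) + a i - b (i - 2) + b (i - 1) - b i) - 3 * c i + c (i - 1))
    (i : ℤ) (h₀ : 5 ≤ c (i - 1)) (h₁ : 5 ≤ c i) : c (i - 1) = 6 ∧ c i = 6 := by
  have s₀ := hs i
  have s₁ := hs (i - 1)
  have s₂ := hs (i - 2)
  rw [show i - 1 - 1 = i - 2 by ring, show i - 1 - 2 = i - 3 by ring] at s₁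
  rw [show i - 2 - 1 = i - 3 by ring, show i - 2 - 2 = i - 4 by ring] at s₂
  have a₀ := ha i
  have a₁ := ha (i - 1)
  have a₂ := ha (i - 2)
  have a₃ := ha (i - 3)
  have b₀ := hb i
  have b₁ := hb (i - 1)
  have b₂ := hb (i - 2)
  have b₃ := hb (i - 3)
  have b₄ := hb (i - 4)
  have c₀ := hc i
  have c₁ := hc (i - 1)
  have c₂ := hc (i - 2)
  have c₃ := hc (i - 3)
  omega


/-- In the carry-sequence setup, if `c_i = 5` then `c_{i−1} ≤ 4` and `c_{i+1} ≤ 4`. -/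
theorem carry_five_neighbors_le_four
    (m : ℕ) (hm : 0 < m)
    (a b c : ℤ → ℤ)
    (ha : ∀ i, 0 ≤ a i ∧ a i ≤ 2) (hap : ∀ i, a (i + (m : ℤ)) = a i)
    (hb : ∀ i, 0 ≤ b i ∧ b i ≤ 2) (hbp : ∀ i, b (i + (m : ℤ)) = b i)
    (hc : ∀ i, 0 ≤ c i ∧ c i ≤ 6) (hcp : ∀ i, c (i + (m : ℤ)) = c i)
    (hs : ∀ i, 0 ≤ (9 - 2 * a (i - 1) + a i - b (i - 2) + b (i - 1) - b i) - 3 * c i + c (i - 1) ∧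
      (9 - 2 * a (i - 1) + a i - b (i - 2) + b (i - 1) - b i) - 3 * c i + c (i - 1) ≤ 2) :
    ∀ i, c i = 5 → c (i - 1) ≤ 4 ∧ c (i + 1) ≤ 4 := by
  intro i hi
  have prev := not_consecutive_carries_ge_five a b c ha hb hc (fun j => (hs j).1) i
  have next := not_consecutive_carries_ge_five a b c ha hb hc (fun j => (hs j).1) (i + 1)
  rw [add_sub_cancel_right] at next
  omega
end
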